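/- arXiv:1501.05398 — 4 statements merged into one kernel-verified Lean document; each statement's English description precedes it below -/
import Mathlib

section
/- Let m, n ≥ 4 be integers. The Cartesian product graph P_m × C_n of the path on m vertices and the cycle on n vertices is 2-extendable if and only if at least one of the integers m and n is even. -/
open SimpleGraph

/-- A set of edges of `G` forming a matching: pairwise disjoint edges of `G`. -/
def IsMatchingSet {V : Type*} (G : SimpleGraph V) (M : Set (Sym2 V)) : Prop :=
  M ⊆ G.edgeSet ∧ M.Pairwise fun e f => ∀ v, v ∈ e → v ∉ f

/-- A perfect matching of `G`: a matching covering every vertex. -/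
def IsPerfectMatchingSet {V : Type*} (G : SimpleGraph V) (M : Set (Sym2 V)) : Prop :=
  IsMatchingSet G M ∧ ∀ v : V, ∃ e ∈ M, v ∈ e

/-- `G` is `k`-extendable: it has a perfect matching, and every `k`-matching
extends to a perfect matching. -/
def Extendable {V : Type*} (G : SimpleGraph V) (k : ℕ) : Prop :=
  (∃ P, IsPerfectMatchingSet G P) ∧
    ∀ M : Set (Sym2 V), IsMatchingSet G M → M.ncard = k →
      ∃ P, IsPerfectMatchingSet G P ∧ M ⊆ P

/-- The cycle graph on `n` vertices, with vertex set `ZMod n`. -/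
def cycleZMod (n : ℕ) : SimpleGraph (ZMod n) :=
  SimpleGraph.fromRel fun a b => b = a + 1

/-- Some perfect matching of `G`, given as an involution along edges, matches `a` with `b` and
`c` with `d`. -/
def JointlyMatched {V : Type*} (G : SimpleGraph V) (a b c d : V) : Prop :=
  ∃ p : V → V, Function.Involutive p ∧ (∀ v, G.Adj v (p v)) ∧ p a = b ∧ p c = d

namespace JointlyMatched

variable {V : Type*} {G : SimpleGraph V} {a b c d : V}

lemma swap_left (h : JointlyMatched G a b c d) : JointlyMatched G b a c d := by
  obtain ⟨p, hp, hG, rfl, rfl⟩ := h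
  exact ⟨p, hp, hG, hp a, rfl⟩

lemma swap (h : JointlyMatched G a b c d) : JointlyMatched G c d a b := by
  obtain ⟨p, hp, hG, h₁, h₂⟩ := h
  exact ⟨p, hp, hG, h₂, h₁⟩

lemma exists_isPerfectMatchingSet (h : JointlyMatched G a b c d) :
    ∃ P, IsPerfectMatchingSet G P ∧ {s(a, b), s(c, d)} ⊆ P := by
  obtain ⟨p, hp, hG, rfl, rfl⟩ := h
  refine ⟨Set.range fun v => s(v, p v), ⟨⟨?_, ?_⟩, fun v => ⟨_, ⟨v, rfl⟩, by simp⟩⟩, ?_⟩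
  · rintro _ ⟨v, rfl⟩
    exact hG v
  · rintro _ ⟨v, rfl⟩ _ ⟨w, rfl⟩ hne u hu hu'
    have key : ∀ v, u ∈ s(v, p v) → s(v, p v) = s(u, p u) := by
      intro v hv
      rcases Sym2.mem_iff.1 hv with rfl | rfl
      · rfl
      · rw [hp v, Sym2.eq_swap]
    exact hne ((key v hu).trans (key w hu').symm)
  · rintro _ (rfl | rfl)
    exacts [⟨a, rfl⟩, ⟨c, rfl⟩]

end JointlyMatched

lemma IsPerfectMatchingSet.even_card {V : Type*} [Fintype V] {G : SimpleGraph V}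
    {P : Set (Sym2 V)} (hP : IsPerfectMatchingSet G P) : Even (Fintype.card V) := by
  obtain ⟨⟨hG, hd⟩, hc⟩ := hP
  let M : G.Subgraph :=
    { verts := Set.univ
      Adj := fun v w => s(v, w) ∈ P
      adj_sub := fun h => hG h
      edge_vert := fun _ => trivial
      symm := ⟨fun v w h => by rwa [Sym2.eq_swap]⟩ }
  refine SimpleGraph.Subgraph.IsPerfectMatching.even_card (M := M)
    (SimpleGraph.Subgraph.isPerfectMatching_iff.2 fun v => ?_)
  obtain ⟨e, he, hv⟩ := hc v
  obtain ⟨w, rfl⟩ := Sym2.mem_iff_exists.1 hv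
  refine ⟨w, he, fun w' hw' => ?_⟩
  by_contra hne
  refine hd he hw' (fun h => hne ?_) v (by simp) (by simp)
  grind

/-- A perfect matching of `A □ B` from vertical partners `σ j i` and horizontal partners `τ i j`;
the vertex `(i, j)` is matched horizontally exactly when `σ j i = i`. -/
lemma exists_involutive_boxProd {V W : Type*} {A : SimpleGraph V} {B : SimpleGraph W}
    (σ : W → V → V) (τ : V → W → W)
    (hσ : ∀ j i, σ j i ≠ i → σ j (σ j i) = i ∧ A.Adj i (σ j i))
    (hτ : ∀ i j, σ j i = i → τ i (τ i j) = j ∧ B.Adj j (τ i j) ∧ σ (τ i j) i = i) :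
    ∃ p : V × W → V × W, Function.Involutive p ∧ (∀ v, (A □ B).Adj v (p v)) ∧
      (∀ i j, σ j i = i → p (i, j) = (i, τ i j)) ∧ ∀ i j, σ j i ≠ i → p (i, j) = (σ j i, j) := by
  classical
  refine ⟨fun v => if σ v.2 v.1 = v.1 then (v.1, τ v.1 v.2) else (σ v.2 v.1, v.2), ?_, ?_, ?_, ?_⟩
  · rintro ⟨i, j⟩
    by_cases h : σ j i = i
    · simp [h, hτ i j h]
    · simp [h, hσ j i h, Ne.symm h]
  · rintro ⟨i, j⟩
    by_cases h : σ j i = i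
    · simp [h, hτ i j h]
    · simp [h, hσ j i h]
  · intro i j h
    simp [h]
  · intro i j h
    simp [h]

section EvenPath

variable {V : Type*} {A : SimpleGraph V} {W : Type*} {B : SimpleGraph W} {μ : V → V}

lemma exists_involutive_disjoint_column_pairs (hμ : Function.Involutive μ) (hA : ∀ i, A.Adj i (μ i))
    {s t : V → V} (hs : ∀ i, s i ≠ i → s (s i) = i ∧ A.Adj i (s i))
    (ht : ∀ i, t i ≠ i → t (t i) = i ∧ A.Adj i (t i)) {x y z w : W}
    (hxy : B.Adj x y) (hzw : B.Adj z w) (hxz : x ≠ z) (hxw : x ≠ w) (hyz : y ≠ z) (hyw : y ≠ w) :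
    ∃ p : V × W → V × W, Function.Involutive p ∧ (∀ v, (A □ B).Adj v (p v)) ∧
      (∀ i, s i = i → p (i, x) = (i, y)) ∧ (∀ i, s i ≠ i → p (i, x) = (s i, x)) ∧
      (∀ i, t i = i → p (i, z) = (i, w)) ∧ ∀ i, t i ≠ i → p (i, z) = (t i, z) := by
  classical
  have hμ' := fun i => (hA i).ne
  have h1 := hxy.ne
  have h2 := hzw.ne
  have h1' := hxy.symm
  have h2' := hzw.symm
  have hμ2 : ∀ i, μ (μ i) = i := hμ
  obtain ⟨p, hp, hadj, hH, hV⟩ := exists_involutive_boxProd (A := A) (B := B)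
    (fun j => if j = x ∨ j = y then s else if j = z ∨ j = w then t else μ)
    (fun _ j => if j = x then y else if j = y then x else if j = z then w else
      if j = w then z else j) (by grind) (by grind)
  refine ⟨p, hp, hadj, ?_, ?_, ?_, ?_⟩ <;> grind

lemma exists_involutive_column_pair (hμ : Function.Involutive μ) (hA : ∀ i, A.Adj i (μ i))
    {s : V → V} (hs : ∀ i, s i ≠ i → s (s i) = i ∧ A.Adj i (s i)) {x y : W} (hxy : B.Adj x y) :
    ∃ p : V × W → V × W, Function.Involutive p ∧ (∀ v, (A □ B).Adj v (p v)) ∧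
      (∀ i, s i = i → p (i, x) = (i, y)) ∧ (∀ i, s i ≠ i → p (i, x) = (s i, x)) := by
  classical
  have hμ' := fun i => (hA i).ne
  have h1 := hxy.ne
  have h1' := hxy.symm
  have hμ2 : ∀ i, μ (μ i) = i := hμ
  obtain ⟨p, hp, hadj, hH, hV⟩ := exists_involutive_boxProd (A := A) (B := B)
    (fun j => if j = x ∨ j = y then s else μ)
    (fun _ j => if j = x then y else if j = y then x else j) (by grind) (by grind)
  refine ⟨p, hp, hadj, ?_, ?_⟩ <;> grind

lemma jointlyMatched_of_row_pairs (hμ : Function.Involutive μ) (hA : ∀ i, A.Adj i (μ i))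
    {r q : V} (hrq : r ≠ q) (hrq' : μ r ≠ q) {x y z w : W} (hxy : B.Adj x y) (hzw : B.Adj z w) :
    JointlyMatched (A □ B) (r, x) (r, y) (q, z) (q, w) := by
  classical
  have hμ' := fun i => (hA i).ne
  have h1 := hxy.ne
  have h2 := hzw.ne
  have h1' := hxy.symm
  have h2' := hzw.symm
  have hμ2 : ∀ i, μ (μ i) = i := hμ
  obtain ⟨p, hp, hadj, hH, hV⟩ := exists_involutive_boxProd (A := A) (B := B)
    (fun j i => if ((i = r ∨ i = μ r) ∧ (j = x ∨ j = y)) ∨ ((i = q ∨ i = μ q) ∧ (j = z ∨ j = w))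
      then i else μ i)
    (fun i j => if i = r ∨ i = μ r then (if j = x then y else x) else
      (if j = z then w else z)) (by grind) (by grind)
  exact ⟨p, hp, hadj, by grind, by grind⟩

/-- A four-by-four tile for two horizontal edges in paired rows whose columns overlap. -/
lemma exists_involutive_tile (hμ : Function.Involutive μ) (hA : ∀ i, A.Adj i (μ i))
    {b c : V} (hbc : A.Adj b c) (hbc' : μ b ≠ c) {x₀ x₁ x₂ x₃ : W}
    (h₀₁ : B.Adj x₀ x₁) (h₁₂ : B.Adj x₁ x₂) (h₂₃ : B.Adj x₂ x₃)
    (h₀₂ : x₀ ≠ x₂) (h₀₃ : x₀ ≠ x₃) (h₁₃ : x₁ ≠ x₃) :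
    ∃ p : V × W → V × W, Function.Involutive p ∧ (∀ v, (A □ B).Adj v (p v)) ∧
      p (b, x₁) = (b, x₂) ∧ p (μ b, x₀) = (μ b, x₁) ∧ p (μ b, x₂) = (μ b, x₃) := by
  classical
  have hμ' := fun i => (hA i).ne
  have h1 := h₀₁.ne
  have h2 := h₁₂.ne
  have h3 := h₂₃.ne
  have h1' := h₀₁.symm
  have h2' := h₁₂.symm
  have h3' := h₂₃.symm
  have h4 := hbc.ne
  have h4' := hbc.symm
  have hμ2 : ∀ i, μ (μ i) = i := hμ
  obtain ⟨p, hp, hadj, hH, hV⟩ := exists_involutive_boxProd (A := A) (B := B)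
    (fun j i =>
      if j = x₀ ∨ j = x₃ then
        (if i = b then c else if i = c then b else if i = μ b ∨ i = μ c then i else μ i)
      else if j = x₁ ∨ j = x₂ then
        (if i = b ∨ i = c ∨ i = μ b ∨ i = μ c then i else μ i)
      else μ i)
    (fun i j => if i = b ∨ i = c then (if j = x₁ then x₂ else x₁) else
      (if j = x₀ then x₁ else if j = x₁ then x₀ else if j = x₂ then x₃ else x₂))
    (by grind) (by grind (splits := 20))
  exact ⟨p, hp, hadj, by grind, by grind, by grind⟩

end EvenPath

section Cycle

lemma ZMod.natCast_ne_zero_of_lt {n k : ℕ} (hk : 0 < k) (hkn : k < n) : (k : ZMod n) ≠ 0 := by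
  rw [Ne, ZMod.natCast_eq_zero_iff]
  exact fun h => absurd (Nat.le_of_dvd hk h) (by omega)

lemma cycleZMod_adj {n : ℕ} (hn : 1 < n) {a b : ZMod n} :
    (cycleZMod n).Adj a b ↔ b = a + 1 ∨ a = b + 1 := by
  have h : (1 : ZMod n) ≠ 0 := by simpa using ZMod.natCast_ne_zero_of_lt one_pos hn
  simp only [cycleZMod, SimpleGraph.fromRel_adj]
  grind

lemma ZMod.one_two_three_ne_zero {n : ℕ} (hn : 4 ≤ n) :
    (1 : ZMod n) ≠ 0 ∧ (2 : ZMod n) ≠ 0 ∧ (3 : ZMod n) ≠ 0 :=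
  ⟨by simpa using ZMod.natCast_ne_zero_of_lt (n := n) (k := 1) (by omega) (by omega),
    by simpa using ZMod.natCast_ne_zero_of_lt (n := n) (k := 2) (by omega) (by omega),
    by simpa using ZMod.natCast_ne_zero_of_lt (n := n) (k := 3) (by omega) (by omega)⟩

lemma cycleZMod_adj_add_one {n : ℕ} (hn : 4 ≤ n) (a : ZMod n) : (cycleZMod n).Adj a (a + 1) :=
  (cycleZMod_adj (by omega)).2 (Or.inl rfl)

lemma exists_disjoint_cycleZMod_adj {n : ℕ} (hn : 4 ≤ n) {j l : ZMod n} (hjl : j ≠ l) :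
    ∃ j' l', (cycleZMod n).Adj j j' ∧ (cycleZMod n).Adj l l' ∧ j ≠ l' ∧ j' ≠ l ∧ j' ≠ l' := by
  obtain ⟨h1, h2, h3⟩ := ZMod.one_two_three_ne_zero hn
  simp only [cycleZMod_adj (show 1 < n by omega)]
  by_cases hl : l = j + 1
  · exact ⟨j - 1, l + 1, by grind, by grind, by grind,
      fun h => h2 (by linear_combination -hl - h), by grind⟩
  · by_cases hj : j = l + 1
    · exact ⟨j + 1, l - 1, by grind, by grind, by grind, by grind, by grind⟩
    · exact ⟨j + 1, l + 1, by grind, by grind, by grind, by grind, by grind⟩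

lemma exists_cycleZMod_adj_ne {n : ℕ} (hn : 4 ≤ n) {x k : ZMod n} (hk : k ≠ x)
    (hk' : k ≠ x + 1) : ∃ l, (cycleZMod n).Adj k l ∧ l ≠ x ∧ l ≠ x + 1 := by
  obtain ⟨h1, h2, h3⟩ := ZMod.one_two_three_ne_zero hn
  simp only [cycleZMod_adj (show 1 < n by omega)]
  by_cases hl : k = x + 2
  · exact ⟨k + 1, by grind, by grind, by grind⟩
  · exact ⟨k - 1, by grind, by grind, by grind⟩

/-- The perfect matching of an even cycle whose edges `{j, j + 1}` start at parity `φ`. -/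
noncomputable def parityPartner {n : ℕ} (h : 2 ∣ n) (φ : ZMod 2) (j : ZMod n) : ZMod n :=
  if ZMod.castHom h (ZMod 2) j = φ then j + 1 else j - 1

lemma ZMod.eq_add_one_of_ne {a b : ZMod 2} (h : a ≠ b) : a = b + 1 := by
  revert a b
  decide

lemma parityPartner_parityPartner {n : ℕ} (h : 2 ∣ n) (φ : ZMod 2) (j : ZMod n) :
    parityPartner h φ (parityPartner h φ j) = j := by
  have h2 : (1 : ZMod 2) ≠ 0 := by decide
  unfold parityPartner
  by_cases hj : ZMod.castHom h (ZMod 2) j = φ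
  · have : ZMod.castHom h (ZMod 2) (j + 1) ≠ φ := by rw [map_add, map_one]; grind
    simp only [hj, this, if_true, if_false]
    ring
  · have := ZMod.eq_add_one_of_ne hj
    have : ZMod.castHom h (ZMod 2) (j - 1) = φ := by rw [map_sub, map_one]; grind
    simp only [hj, this, if_true, if_false]
    ring

lemma parityPartner_adj {n : ℕ} (hn : 4 ≤ n) (h : 2 ∣ n) (φ : ZMod 2) (j : ZMod n) :
    (cycleZMod n).Adj j (parityPartner h φ j) := by
  rw [cycleZMod_adj (by omega), parityPartner]
  grind

lemma parityPartner_self {n : ℕ} (h : 2 ∣ n) (j : ZMod n) :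
    parityPartner h (ZMod.castHom h (ZMod 2) j) j = j + 1 := by
  simp [parityPartner]

lemma exists_parityPartner_ne {n : ℕ} (hn : 4 ≤ n) (h : 2 ∣ n) (j l : ZMod n) :
    ∃ φ, parityPartner h φ j ≠ l := by
  obtain ⟨-, h2, -⟩ := ZMod.one_two_three_ne_zero hn
  by_contra! hc
  have h1 := hc (ZMod.castHom h (ZMod 2) j)
  have h3 := hc (ZMod.castHom h (ZMod 2) j + 1)
  simp only [parityPartner, left_eq_add, one_ne_zero, if_true, if_false] at h1 h3
  exact h2 (by linear_combination h1 - h3)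

end Cycle

section EvenPath

variable {V : Type*} {A : SimpleGraph V} {μ : V → V} {n : ℕ}

lemma jointlyMatched_vertical_of_involutive (hμ : Function.Involutive μ)
    (hA : ∀ i, A.Adj i (μ i)) (hn : 4 ≤ n) {i i' k k' : V} (hi : A.Adj i i') (hk : A.Adj k k')
    {j l : ZMod n} (hd : j = l → i ≠ k ∧ i ≠ k' ∧ i' ≠ k ∧ i' ≠ k') :
    JointlyMatched (A □ cycleZMod n) (i, j) (i', j) (k, l) (k', l) := by
  classical
  have hi1 := hi.ne
  have hk1 := hk.ne
  have hi2 := hi.symm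
  have hk2 := hk.symm
  by_cases hjl : j = l
  · subst hjl
    obtain ⟨p, hp, hadj, hH, hV⟩ := exists_involutive_column_pair hμ hA
      (s := fun t => if t = i then i' else if t = i' then i else if t = k then k' else
        if t = k' then k else t) (by grind) (cycleZMod_adj_add_one hn j)
    exact ⟨p, hp, hadj, by grind, by grind⟩
  · obtain ⟨j', l', hj, hl, h1, h2, h3⟩ := exists_disjoint_cycleZMod_adj hn hjl
    obtain ⟨p, hp, hadj, hH, hV, hH', hV'⟩ := exists_involutive_disjoint_column_pairs hμ hA
      (s := fun t => if t = i then i' else if t = i' then i else t)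
      (t := fun t => if t = k then k' else if t = k' then k else t) (by grind) (by grind)
      hj hl hjl h1 h2 h3
    exact ⟨p, hp, hadj, by grind, by grind⟩

lemma jointlyMatched_horizontal_vertical_of_involutive (hμ : Function.Involutive μ)
    (hA : ∀ i, A.Adj i (μ i)) (hn : 4 ≤ n) {r i i' : V} (hi : A.Adj i i') {x k : ZMod n}
    (hd : k = x ∨ k = x + 1 → r ≠ i ∧ r ≠ i') :
    JointlyMatched (A □ cycleZMod n) (r, x) (r, x + 1) (i, k) (i', k) := by
  classical
  have hi1 := hi.ne
  have hi2 := hi.symm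
  by_cases hk : k = x ∨ k = x + 1
  · obtain ⟨p, hp, hadj, hH, hV⟩ := exists_involutive_column_pair hμ hA
      (s := fun t => if t = i then i' else if t = i' then i else t) (by grind)
      (cycleZMod_adj_add_one hn x)
    obtain ⟨q, hq, hadj', hH', hV'⟩ := exists_involutive_column_pair hμ hA
      (s := fun t => if t = i then i' else if t = i' then i else t) (by grind)
      (cycleZMod_adj_add_one hn x).symm
    rcases hk with rfl | rfl
    · exact ⟨p, hp, hadj, by grind, by grind⟩
    · exact JointlyMatched.swap_left ⟨q, hq, hadj', by grind, by grind⟩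
  · obtain ⟨l, hl, h1, h2⟩ := exists_cycleZMod_adj_ne hn (x := x) (k := k) (by grind) (by grind)
    obtain ⟨p, hp, hadj, hH, hV, hH', hV'⟩ := exists_involutive_disjoint_column_pairs hμ hA
      (s := id) (t := fun t => if t = i then i' else if t = i' then i else t) (by grind)
      (by grind) (cycleZMod_adj_add_one hn x) hl (by grind) (by grind) (by grind) (by grind)
    exact ⟨p, hp, hadj, by grind, by grind⟩

lemma jointlyMatched_horizontal_of_involutive (hμ : Function.Involutive μ)
    (hA : ∀ i, A.Adj i (μ i))
    (hT : ∀ r, ∃ c, (A.Adj r c ∧ μ r ≠ c) ∨ (A.Adj (μ r) c ∧ r ≠ c))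
    (hn : 4 ≤ n) {r q : V} {x z : ZMod n}
    (hd : r = q → x ≠ z ∧ x ≠ z + 1 ∧ x + 1 ≠ z) :
    JointlyMatched (A □ cycleZMod n) (r, x) (r, x + 1) (q, z) (q, z + 1) := by
  obtain ⟨h1, h2, h3⟩ := ZMod.one_two_three_ne_zero hn
  have hadd := cycleZMod_adj_add_one hn
  by_cases hxz : x = z
  · subst hxz
    obtain ⟨p, hp, hadj, hH, hV⟩ := exists_involutive_column_pair hμ hA
      (s := id) (by grind) (hadd x)
    exact ⟨p, hp, hadj, by grind, by grind⟩
  by_cases hov : x = z + 1 ∨ x + 1 = z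
  · have hrq : r ≠ q := by grind
    by_cases hrq' : μ r = q
    · subst hrq'
      have tile : ∀ b c : V, A.Adj b c → μ b ≠ c → ∀ y : ZMod n,
          JointlyMatched (A □ cycleZMod n) (b, y) (b, y + 1) (μ b, y + 1) (μ b, y + 1 + 1) ∧
          JointlyMatched (A □ cycleZMod n) (b, y) (b, y + 1) (μ b, y - 1) (μ b, y) := by
        intro b c hbc hbc' y
        obtain ⟨p, hp, hadj, e1, e2, e3⟩ := exists_involutive_tile hμ hA hbc hbc'
          (x₀ := y - 1) (x₁ := y) (x₂ := y + 1) (x₃ := y + 1 + 1)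
          (by simpa using hadd (y - 1)) (hadd y) (hadd (y + 1))
          (by grind) (by grind) (by grind)
        exact ⟨⟨p, hp, hadj, e1, e3⟩, ⟨p, hp, hadj, e1, e2⟩⟩
      obtain ⟨c, ⟨hc, hc'⟩ | ⟨hc, hc'⟩⟩ := hT r
      · rcases hov with rfl | rfl
        · simpa using (tile r c hc hc' (z + 1)).2
        · exact (tile r c hc hc' x).1
      · have ht := tile (μ r) c hc (by rwa [hμ r])
        rw [hμ r] at ht
        rcases hov with rfl | rfl
        · exact (ht z).1.swap
        · simpa using (ht (x + 1)).2.swap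
    · exact jointlyMatched_of_row_pairs hμ hA hrq hrq' (hadd x) (hadd z)
  · obtain ⟨p, hp, hadj, hH, hV, hH', hV'⟩ := exists_involutive_disjoint_column_pairs hμ hA
      (s := id) (t := id) (by grind)
      (by grind) (hadd x) (hadd z) (by grind) (by grind) (by grind) (by grind)
    exact ⟨p, hp, hadj, by grind, by grind⟩

end EvenPath

section EvenCycle

variable {V : Type*} {A : SimpleGraph V} {n : ℕ}

lemma jointlyMatched_vertical_of_even_cycle (hn : 4 ≤ n) (h : 2 ∣ n) {i i' k k' : V}
    (hi : A.Adj i i') (hk : A.Adj k k')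
    {j l : ZMod n} (hd : j = l → i ≠ k ∧ i ≠ k' ∧ i' ≠ k ∧ i' ≠ k') :
    JointlyMatched (A □ cycleZMod n) (i, j) (i', j) (k, l) (k', l) := by
  classical
  have hi1 := hi.ne
  have hk1 := hk.ne
  have hi2 := hi.symm
  have hk2 := hk.symm
  obtain ⟨φ, hφ⟩ := exists_parityPartner_ne hn h j l
  have hN := parityPartner_parityPartner h φ
  have hNadj := parityPartner_adj hn h φ
  generalize parityPartner h φ = N at *
  have hN' := fun j => (hNadj j).ne
  by_cases hjl : j = l
  · subst hjl
    obtain ⟨p, hp, hadj, hH, hV⟩ := exists_involutive_boxProd (A := A) (B := cycleZMod n)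
      (fun c t => if c = j ∨ c = N j then (if t = i then i' else if t = i' then i else
        if t = k then k' else if t = k' then k else t) else t)
      (fun _ => N) (by grind) (by grind)
    exact ⟨p, hp, hadj, by grind, by grind⟩
  · obtain ⟨p, hp, hadj, hH, hV⟩ := exists_involutive_boxProd (A := A) (B := cycleZMod n)
      (fun c t => if c = j ∨ c = N j then (if t = i then i' else if t = i' then i else t) else
        if c = l ∨ c = N l then (if t = k then k' else if t = k' then k else t) else t)
      (fun _ => N) (by grind) (by grind (splits := 20))
    exact ⟨p, hp, hadj, by grind, by grind⟩

lemma jointlyMatched_horizontal_vertical_of_even_cycle (hn : 4 ≤ n) (h : 2 ∣ n) {r i i' : V}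
    (hi : A.Adj i i') {x k : ZMod n} (hd : k = x ∨ k = x + 1 → r ≠ i ∧ r ≠ i') :
    JointlyMatched (A □ cycleZMod n) (r, x) (r, x + 1) (i, k) (i', k) := by
  classical
  have hi1 := hi.ne
  have hi2 := hi.symm
  have hx := parityPartner_self h x
  have hN := parityPartner_parityPartner h (ZMod.castHom h (ZMod 2) x)
  have hNadj := parityPartner_adj hn h (ZMod.castHom h (ZMod 2) x)
  generalize parityPartner h (ZMod.castHom h (ZMod 2) x) = N at *
  have hN' := fun j => (hNadj j).ne
  obtain ⟨p, hp, hadj, hH, hV⟩ := exists_involutive_boxProd (A := A) (B := cycleZMod n)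
    (fun c t => if c = k ∨ c = N k then (if t = i then i' else if t = i' then i else t) else t)
    (fun _ => N) (by grind) (by grind)
  exact ⟨p, hp, hadj, by grind, by grind⟩

lemma jointlyMatched_horizontal_of_even_cycle (hn : 4 ≤ n) (h : 2 ∣ n)
    (hT : ∀ r, ∃ c, A.Adj r c) {r q : V} {x z : ZMod n}
    (hd : r = q → x ≠ z ∧ x ≠ z + 1 ∧ x + 1 ≠ z) :
    JointlyMatched (A □ cycleZMod n) (r, x) (r, x + 1) (q, z) (q, z + 1) := by
  classical
  obtain ⟨h1, h2, h3⟩ := ZMod.one_two_three_ne_zero hn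
  have hadd := cycleZMod_adj_add_one hn
  have hadd' := fun j => (hadd j).symm
  have hx := parityPartner_self h x
  have hN := parityPartner_parityPartner h (ZMod.castHom h (ZMod 2) x)
  have hNadj := parityPartner_adj hn h (ZMod.castHom h (ZMod 2) x)
  have hz := parityPartner_self h z
  have hM := parityPartner_parityPartner h (ZMod.castHom h (ZMod 2) z)
  have hMadj := parityPartner_adj hn h (ZMod.castHom h (ZMod 2) z)
  generalize parityPartner h (ZMod.castHom h (ZMod 2) x) = N at *
  generalize parityPartner h (ZMod.castHom h (ZMod 2) z) = M at *
  by_cases hrq : r = q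
  · subst hrq
    obtain ⟨c, hc⟩ := hT r
    have hc1 := hc.ne
    have hc2 := hc.symm
    obtain ⟨p, hp, hadj, hH, hV⟩ := exists_involutive_boxProd (A := A) (B := cycleZMod n)
      (fun j t => if j = x ∨ j = x + 1 ∨ j = z ∨ j = z + 1 then t else
        if t = r then c else if t = c then r else t)
      (fun t j => if t = r ∨ t = c then (if j = x then x + 1 else if j = x + 1 then x else
        if j = z then z + 1 else z) else N j) (by grind) (by grind (splits := 20))
    exact ⟨p, hp, hadj, by grind, by grind⟩
  · obtain ⟨p, hp, hadj, hH, hV⟩ := exists_involutive_boxProd (A := A) (B := cycleZMod n)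
      (fun _ t => t) (fun t => if t = r then N else M) (by grind) (by grind)
    exact ⟨p, hp, hadj, by grind, by grind⟩

end EvenCycle

lemma mem_edgeSet_boxProd_cycleZMod {V : Type*} {A : SimpleGraph V} {n : ℕ} (hn : 4 ≤ n)
    {e : Sym2 (V × ZMod n)} (he : e ∈ (A □ cycleZMod n).edgeSet) :
    (∃ i i' j, A.Adj i i' ∧ e = s((i, j), (i', j))) ∨ ∃ r x, e = s((r, x), (r, x + 1)) := by
  induction e using Sym2.ind with
  | _ a b =>
    obtain ⟨i, j⟩ := a
    obtain ⟨i', j'⟩ := b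
    rw [SimpleGraph.mem_edgeSet, SimpleGraph.boxProd_adj, cycleZMod_adj (by omega)] at he
    dsimp only at he
    obtain ⟨h, rfl⟩ | ⟨rfl | rfl, rfl⟩ := he
    · exact Or.inl ⟨i, i', j, h, rfl⟩
    · exact Or.inr ⟨i, j, rfl⟩
    · exact Or.inr ⟨i, j', Sym2.eq_swap⟩

lemma extendable_two_boxProd_cycleZMod {V : Type*} {A : SimpleGraph V} {n : ℕ} (hn : 4 ≤ n)
    [Nonempty V]
    (hVV : ∀ {i i' k k' : V}, A.Adj i i' → A.Adj k k' → ∀ {j l : ZMod n},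
      (j = l → i ≠ k ∧ i ≠ k' ∧ i' ≠ k ∧ i' ≠ k') →
      JointlyMatched (A □ cycleZMod n) (i, j) (i', j) (k, l) (k', l))
    (hHV : ∀ {r i i' : V}, A.Adj i i' → ∀ {x k : ZMod n},
      (k = x ∨ k = x + 1 → r ≠ i ∧ r ≠ i') →
      JointlyMatched (A □ cycleZMod n) (r, x) (r, x + 1) (i, k) (i', k))
    (hHH : ∀ {r q : V} {x z : ZMod n}, (r = q → x ≠ z ∧ x ≠ z + 1 ∧ x + 1 ≠ z) →
      JointlyMatched (A □ cycleZMod n) (r, x) (r, x + 1) (q, z) (q, z + 1)) :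
    Extendable (A □ cycleZMod n) 2 := by
  constructor
  · obtain ⟨r⟩ := ‹Nonempty V›
    obtain ⟨h1, h2, h3⟩ := ZMod.one_two_three_ne_zero hn
    have h := hHH (r := r) (q := r) (x := 0) (z := 2) fun _ =>
      ⟨h2.symm, fun h => h3 (by linear_combination -h), fun h => h1 (by linear_combination -h)⟩
    exact h.exists_isPerfectMatchingSet.imp fun _ => And.left
  · rintro M ⟨hM, hd⟩ hcard
    obtain ⟨e, f, hef, rfl⟩ := Set.ncard_eq_two.1 hcard
    have hdisj : ∀ v, v ∈ e → v ∉ f := hd (by simp) (by simp) hef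
    rcases mem_edgeSet_boxProd_cycleZMod hn (hM (show e ∈ _ by simp)) with
      ⟨i, i', j, hi, rfl⟩ | ⟨r, x, rfl⟩ <;>
    rcases mem_edgeSet_boxProd_cycleZMod hn (hM (show f ∈ _ by simp)) with
      ⟨k, k', l, hk, rfl⟩ | ⟨q, z, rfl⟩ <;>
    simp only [Sym2.mem_iff, forall_eq_or_imp, forall_eq, Prod.mk.injEq] at hdisj
    · exact (hVV hi hk (by grind)).exists_isPerfectMatchingSet
    · exact (hHV hi (by grind)).swap.exists_isPerfectMatchingSet
    · exact (hHV hk (by grind)).exists_isPerfectMatchingSet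
    · exact (hHH (by grind)).exists_isPerfectMatchingSet

/-- The perfect matching `{0, 1}, {2, 3}, …` of a path on an even number of vertices. -/
def pathPartner {m : ℕ} (hm : Even m) (i : Fin m) : Fin m :=
  if h : (i : ℕ) % 2 = 0 then ⟨i + 1, by obtain ⟨k, rfl⟩ := hm; omega⟩ else ⟨i - 1, by omega⟩

lemma pathPartner_involutive {m : ℕ} (hm : Even m) : Function.Involutive (pathPartner hm) := by
  intro i
  ext
  simp only [pathPartner]
  grind

lemma pathPartner_adj {m : ℕ} (hm : Even m) (i : Fin m) :
    (SimpleGraph.pathGraph m).Adj i (pathPartner hm i) := by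
  rw [SimpleGraph.pathGraph_adj, pathPartner]
  grind

lemma exists_pathGraph_adj {m : ℕ} (hm : 2 ≤ m) (r : Fin m) :
    ∃ c, (SimpleGraph.pathGraph m).Adj r c := by
  simp only [SimpleGraph.pathGraph_adj]
  by_cases h : (r : ℕ) = 0
  · exact ⟨⟨1, by omega⟩, by simp [h]⟩
  · exact ⟨⟨r - 1, by omega⟩, by simp only; omega⟩

lemma exists_pathGraph_adj_ne_pathPartner {m : ℕ} (hm : Even m) (hm4 : 4 ≤ m) (r : Fin m) :
    ∃ c, ((SimpleGraph.pathGraph m).Adj r c ∧ pathPartner hm r ≠ c) ∨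
      ((SimpleGraph.pathGraph m).Adj (pathPartner hm r) c ∧ r ≠ c) := by
  simp only [SimpleGraph.pathGraph_adj, pathPartner, Fin.ext_iff, Ne]
  by_cases h : 2 ≤ (r : ℕ)
  · refine ⟨⟨r / 2 * 2 - 1, by omega⟩, ?_⟩
    split_ifs <;> simp only <;> omega
  · refine ⟨⟨2, by omega⟩, ?_⟩
    split_ifs <;> simp only <;> omega

/-- For `m, n ≥ 4`, the Cartesian product `P_m × C_n` is `2`-extendable
if and only if `m` or `n` is even. -/
theorem pathGraph_boxProd_cycle_two_extendable_iff (m n : ℕ) (hm : 4 ≤ m) (hn : 4 ≤ n) :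
    Extendable (SimpleGraph.pathGraph m □ cycleZMod n) 2 ↔ (Even m ∨ Even n) := by
  have : NeZero m := ⟨by omega⟩
  have : NeZero n := ⟨by omega⟩
  constructor
  · rintro ⟨⟨P, hP⟩, -⟩
    have h := hP.even_card
    rwa [Fintype.card_prod, Fintype.card_fin, ZMod.card, Nat.even_mul] at h
  · rintro (h | h)
    · have hμ := pathPartner_involutive h
      have hA := pathPartner_adj h
      exact extendable_two_boxProd_cycleZMod hn
        (jointlyMatched_vertical_of_involutive hμ hA hn)
        (jointlyMatched_horizontal_vertical_of_involutive hμ hA hn)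
        (jointlyMatched_horizontal_of_involutive hμ hA
          (exists_pathGraph_adj_ne_pathPartner h hm) hn)
    · have h2 := h.two_dvd
      exact extendable_two_boxProd_cycleZMod hn
        (jointlyMatched_vertical_of_even_cycle hn h2)
        (jointlyMatched_horizontal_vertical_of_even_cycle hn h2)
        (jointlyMatched_horizontal_of_even_cycle hn h2 (exists_pathGraph_adj (by omega)))
end

section
/- Let m ≥ 4 be even and n ≥ 5 be odd. Then the Cartesian product graph P_m × C_n is 2-extendable. -/
open SimpleGraph

/-- A domino tiling of the cylinder with rows `0, …, m - 1` and cyclically arranged columns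
`0, …, n - 1`. The value `H i j` says whether cell `(i, j)` is joined to its cyclic predecessor
in row `i`, and `V i j` whether cell `(i, j)` is joined to cell `(i - 1, j)`. -/
structure CylinderTiling (m n : ℕ) where
  H : ℕ → ℕ → Bool
  V : ℕ → ℕ → Bool
  top : ∀ j, V 0 j = false
  bot : ∀ j, V m j = false
  wrap : ∀ i, H i 0 = H i n
  cover : ∀ i < m, ∀ j < n,
    (H i j).toNat + (H i (j + 1)).toNat + (V i j).toNat + (V (i + 1) j).toNat = 1

namespace CylinderTiling

/-- Insert two new columns just before column `k`, subdividing the dominoes that cross the cut. -/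
def insertCols {m n : ℕ} (T : CylinderTiling m n) (k : ℕ) (hk : k ≤ n) :
    CylinderTiling m (n + 2) where
  H i j := if j ≤ k then T.H i j else if j = k + 1 then !T.H i k else T.H i (j - 2)
  V i j := if j < k then T.V i j else if j ≤ k + 1 then false else T.V i (j - 2)
  top j := by simp [T.top]
  bot j := by simp [T.bot]
  wrap i := by
    rw [if_pos (Nat.zero_le k), if_neg (by omega), if_neg (by omega), T.wrap]
    rfl
  cover i hi j hj := by
    rcases lt_trichotomy j k with h | rfl | h
    · simpa [h, h.le, Nat.succ_le_of_lt h] using T.cover i hi j (by omega)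
    · cases hb : T.H i j <;> simp
    · obtain rfl | h' := (Nat.succ_le_of_lt h).eq_or_lt
      · cases hb : T.H i k <;> simp [hb]
      · obtain ⟨l, rfl⟩ : ∃ l, j = l + 2 := ⟨j - 2, by omega⟩
        have := T.cover i hi l (by omega)
        rw [if_neg (by omega), if_neg (by omega), if_neg (by omega), if_neg (by omega),
          if_neg (by omega), if_neg (by omega), if_neg (by omega), if_neg (by omega)]
        exact this

/-- Insert two new rows just before row `k`, subdividing the dominoes that cross the cut. -/
def insertRows {m n : ℕ} (T : CylinderTiling m n) (k : ℕ) (hk : k ≤ m) :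
    CylinderTiling (m + 2) n where
  H i j := if i < k then T.H i j else if i ≤ k + 1 then false else T.H (i - 2) j
  V i j := if i ≤ k then T.V i j else if i = k + 1 then !T.V k j else T.V (i - 2) j
  top j := by simp [T.top]
  bot j := by
    rw [if_neg (by omega), if_neg (by omega)]
    exact T.bot j
  wrap i := by simp [T.wrap]
  cover i hi j hj := by
    rcases lt_trichotomy i k with h | rfl | h
    · simpa [h, h.le, Nat.succ_le_of_lt h] using T.cover i (by omega) j hj
    · cases hb : T.V i j <;> simp
    · obtain rfl | h' := (Nat.succ_le_of_lt h).eq_or_lt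
      · cases hb : T.V k j <;> simp [hb]
      · obtain ⟨l, rfl⟩ : ∃ l, i = l + 2 := ⟨i - 2, by omega⟩
        have := T.cover l (by omega) j hj
        rw [if_neg (by omega), if_neg (by omega), if_neg (by omega), if_neg (by omega),
          if_neg (by omega), if_neg (by omega), if_neg (by omega), if_neg (by omega)]
        exact this

/-- The index, before two new lines `k` and `k + 1` were inserted, of the line now at `j`. -/
def contract (k j : ℕ) : ℕ := if j ≤ k then j else j - 2

variable {m n : ℕ} (T : CylinderTiling m n)

lemma insertCols_H {k : ℕ} (hk : k ≤ n) (i : ℕ) {j : ℕ} (hj : j ≠ k + 1) :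
    (T.insertCols k hk).H i j = T.H i (contract k j) := by
  simp only [insertCols, contract]
  split_ifs <;> rfl

lemma insertCols_V {k : ℕ} (hk : k ≤ n) (i : ℕ) {j : ℕ} (hj : j ≠ k) (hj' : j ≠ k + 1) :
    (T.insertCols k hk).V i j = T.V i (contract k j) := by
  simp only [insertCols, contract]
  split_ifs <;> first | rfl | omega

lemma insertRows_H {k : ℕ} (hk : k ≤ m) {i : ℕ} (j : ℕ) (hi : i ≠ k) (hi' : i ≠ k + 1) :
    (T.insertRows k hk).H i j = T.H (contract k i) j := by
  simp only [insertRows, contract]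
  split_ifs <;> first | rfl | omega

lemma insertRows_V {k : ℕ} (hk : k ≤ m) {i : ℕ} (j : ℕ) (hi : i ≠ k + 1) :
    (T.insertRows k hk).V i j = T.V (contract k i) j := by
  simp only [insertRows, contract]
  split_ifs <;> rfl

/-- The rotation by `r` of the tiling of `m × 5` whose values of `H` and `V` at `(i, j)` are the
binary digits of `a` and `b` at position `5 * i + j`. -/
def ofBits (m a b r : ℕ) (htop : ∀ j < 5, b.testBit j = false)
    (hbot : ∀ j < 5, b.testBit (5 * m + j) = false)
    (hcover : ∀ i < m, ∀ j < 5, (a.testBit (5 * i + j)).toNat +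
      (a.testBit (5 * i + (j + 1) % 5)).toNat + (b.testBit (5 * i + j)).toNat +
      (b.testBit (5 * (i + 1) + j)).toNat = 1) : CylinderTiling m 5 where
  H i j := a.testBit (5 * i + (j + r) % 5)
  V i j := b.testBit (5 * i + (j + r) % 5)
  top j := by simpa using htop ((j + r) % 5) (Nat.mod_lt _ (by norm_num))
  bot j := hbot ((j + r) % 5) (Nat.mod_lt _ (by norm_num))
  wrap i := by simp
  cover i hi j hj := by
    have := hcover i hi ((j + r) % 5) (Nat.mod_lt _ (by norm_num))
    rwa [Nat.mod_add_mod, add_right_comm j r 1] at this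

/-- The cyclic predecessor of `j` among `0, …, n - 1`. -/
def cyclicPred (n j : ℕ) : ℕ := if j = 0 then n - 1 else j - 1

/-- Any two disjoint dominoes of the `m × n` cylinder occur together in a tiling. -/
structure TwoExtendable (m n : ℕ) : Prop where
  hh : ∀ i₁ < m, ∀ j₁ < n, ∀ i₂ < m, ∀ j₂ < n,
    (i₁ ≠ i₂ ∨ (j₁ ≠ j₂ ∧ cyclicPred n j₁ ≠ j₂ ∧ cyclicPred n j₂ ≠ j₁)) →
    ∃ T : CylinderTiling m n, T.H i₁ j₁ = true ∧ T.H i₂ j₂ = true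
  hv : ∀ i₁ < m, ∀ j₁ < n, ∀ i₂ < m, ∀ j₂ < n, i₂ ≠ 0 →
    ((i₁ ≠ i₂ ∧ i₁ + 1 ≠ i₂) ∨ (j₁ ≠ j₂ ∧ cyclicPred n j₁ ≠ j₂)) →
    ∃ T : CylinderTiling m n, T.H i₁ j₁ = true ∧ T.V i₂ j₂ = true
  vv : ∀ i₁ < m, ∀ j₁ < n, ∀ i₂ < m, ∀ j₂ < n, i₁ ≠ 0 → i₂ ≠ 0 →
    (j₁ ≠ j₂ ∨ (i₁ ≠ i₂ ∧ i₁ + 1 ≠ i₂ ∧ i₂ + 1 ≠ i₁)) →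
    ∃ T : CylinderTiling m n, T.V i₁ j₁ = true ∧ T.V i₂ j₂ = true

/-- A list of encoded tilings of the `m × 5` cylinder whose rotations realise all pairs of
disjoint dominoes. -/
structure IsCertificate (m : ℕ) (L : List (ℕ × ℕ)) : Prop where
  top : ∀ t ∈ L, ∀ j < 5, t.2.testBit j = false
  bot : ∀ t ∈ L, ∀ j < 5, t.2.testBit (5 * m + j) = false
  cover : ∀ t ∈ L, ∀ i < m, ∀ j < 5, (t.1.testBit (5 * i + j)).toNat +
    (t.1.testBit (5 * i + (j + 1) % 5)).toNat + (t.2.testBit (5 * i + j)).toNat +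
    (t.2.testBit (5 * (i + 1) + j)).toNat = 1
  hh : ∀ i₁ < m, ∀ j₁ < 5, ∀ i₂ < m, ∀ j₂ < 5,
    (i₁ ≠ i₂ ∨ (j₁ ≠ j₂ ∧ cyclicPred 5 j₁ ≠ j₂ ∧ cyclicPred 5 j₂ ≠ j₁)) →
    ∃ t ∈ L, ∃ r < 5, t.1.testBit (5 * i₁ + (j₁ + r) % 5) = true ∧
      t.1.testBit (5 * i₂ + (j₂ + r) % 5) = true
  hv : ∀ i₁ < m, ∀ j₁ < 5, ∀ i₂ < m, ∀ j₂ < 5, i₂ ≠ 0 →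
    ((i₁ ≠ i₂ ∧ i₁ + 1 ≠ i₂) ∨ (j₁ ≠ j₂ ∧ cyclicPred 5 j₁ ≠ j₂)) →
    ∃ t ∈ L, ∃ r < 5, t.1.testBit (5 * i₁ + (j₁ + r) % 5) = true ∧
      t.2.testBit (5 * i₂ + (j₂ + r) % 5) = true
  vv : ∀ i₁ < m, ∀ j₁ < 5, ∀ i₂ < m, ∀ j₂ < 5, i₁ ≠ 0 → i₂ ≠ 0 →
    (j₁ ≠ j₂ ∨ (i₁ ≠ i₂ ∧ i₁ + 1 ≠ i₂ ∧ i₂ + 1 ≠ i₁)) →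
    ∃ t ∈ L, ∃ r < 5, t.2.testBit (5 * i₁ + (j₁ + r) % 5) = true ∧
      t.2.testBit (5 * i₂ + (j₂ + r) % 5) = true

lemma IsCertificate.twoExtendable {m : ℕ} {L : List (ℕ × ℕ)} (h : IsCertificate m L) :
    TwoExtendable m 5 where
  hh i₁ hi₁ j₁ hj₁ i₂ hi₂ j₂ hj₂ hd := by
    obtain ⟨t, ht, r, -, h₁, h₂⟩ := h.hh i₁ hi₁ j₁ hj₁ i₂ hi₂ j₂ hj₂ hd
    exact ⟨ofBits m t.1 t.2 r (h.top t ht) (h.bot t ht) (h.cover t ht), h₁, h₂⟩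
  hv i₁ hi₁ j₁ hj₁ i₂ hi₂ j₂ hj₂ h0 hd := by
    obtain ⟨t, ht, r, -, h₁, h₂⟩ := h.hv i₁ hi₁ j₁ hj₁ i₂ hi₂ j₂ hj₂ h0 hd
    exact ⟨ofBits m t.1 t.2 r (h.top t ht) (h.bot t ht) (h.cover t ht), h₁, h₂⟩
  vv i₁ hi₁ j₁ hj₁ i₂ hi₂ j₂ hj₂ h0 h0' hd := by
    obtain ⟨t, ht, r, -, h₁, h₂⟩ := h.vv i₁ hi₁ j₁ hj₁ i₂ hi₂ j₂ hj₂ h0 h0' hd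
    exact ⟨ofBits m t.1 t.2 r (h.top t ht) (h.bot t ht) (h.cover t ht), h₁, h₂⟩

set_option synthInstance.maxSize 4000 in
lemma twoExtendable_four_five : TwoExtendable 4 5 := by
  have h : IsCertificate 4 [(164901, 268544), (67749, 917760), (167937, 280000),
      (165957, 282880), (169125, 262400), (303237, 83200)] := by
    constructor <;> decide +kernel
  exact h.twoExtendable

set_option synthInstance.maxSize 4000 in
lemma twoExtendable_six_five : TwoExtendable 6 5 := by
  have h : IsCertificate 6 [(168854565, 274995456), (553986081, 235405760),
      (344475813, 540147968), (169939077, 289686784), (623020101, 134500608),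
      (171967653, 286720256), (303080613, 79757568)] := by
    constructor <;> decide +kernel
  exact h.twoExtendable

lemma exists_insertCols_hh {n : ℕ} (hn : 5 ≤ n) {j₁ j₂ : ℕ} (h₁ : j₁ < n + 2) (h₂ : j₂ < n + 2)
    (h : j₁ ≠ j₂ ∧ cyclicPred (n + 2) j₁ ≠ j₂ ∧ cyclicPred (n + 2) j₂ ≠ j₁) :
    ∃ k < n, j₁ ≠ k + 1 ∧ j₂ ≠ k + 1 ∧ contract k j₁ ≠ contract k j₂ ∧
      cyclicPred n (contract k j₁) ≠ contract k j₂ ∧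
      cyclicPred n (contract k j₂) ≠ contract k j₁ := by
  unfold cyclicPred contract at *
  have d₁ : j₁ = 0 ∨ j₁ = 1 ∨ j₁ = 2 ∨ j₁ = 3 ∨ j₁ = 4 ∨ j₁ = 5 ∨ 6 ≤ j₁ := by omega
  have d₂ : j₂ = 0 ∨ j₂ = 1 ∨ j₂ = 2 ∨ j₂ = 3 ∨ j₂ = 4 ∨ j₂ = 5 ∨ 6 ≤ j₂ := by omega
  rcases d₁ with d₁ | d₁ | d₁ | d₁ | d₁ | d₁ | d₁ <;>
  rcases d₂ with d₂ | d₂ | d₂ | d₂ | d₂ | d₂ | d₂ <;>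
  first
  | exact ⟨0, by omega, by grind⟩
  | exact ⟨1, by omega, by grind⟩
  | exact ⟨2, by omega, by grind⟩
  | exact ⟨3, by omega, by grind⟩
  | exact ⟨4, by omega, by grind⟩

lemma exists_insertCols_hv {n : ℕ} (hn : 5 ≤ n) {j₁ j₂ : ℕ} (h₂ : j₂ < n + 2)
    (h : j₁ ≠ j₂ ∧ cyclicPred (n + 2) j₁ ≠ j₂) :
    ∃ k < n, j₁ ≠ k + 1 ∧ j₂ ≠ k ∧ j₂ ≠ k + 1 ∧ contract k j₁ ≠ contract k j₂ ∧
      cyclicPred n (contract k j₁) ≠ contract k j₂ := by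
  unfold cyclicPred contract at *
  have d₁ : j₁ = 0 ∨ j₁ = 1 ∨ j₁ = 2 ∨ j₁ = 3 ∨ j₁ = 4 ∨ j₁ = 5 ∨ 6 ≤ j₁ := by omega
  have d₂ : j₂ = 0 ∨ j₂ = 1 ∨ j₂ = 2 ∨ j₂ = 3 ∨ j₂ = 4 ∨ j₂ = 5 ∨ 6 ≤ j₂ := by omega
  rcases d₁ with d₁ | d₁ | d₁ | d₁ | d₁ | d₁ | d₁ <;>
  rcases d₂ with d₂ | d₂ | d₂ | d₂ | d₂ | d₂ | d₂ <;>
  first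
  | exact ⟨0, by omega, by grind⟩
  | exact ⟨1, by omega, by grind⟩
  | exact ⟨2, by omega, by grind⟩
  | exact ⟨3, by omega, by grind⟩
  | exact ⟨4, by omega, by grind⟩

lemma exists_two_untouched {n : ℕ} (hn : 5 ≤ n) (j₁ j₂ : ℕ) :
    ∃ k < n, j₁ ≠ k ∧ j₁ ≠ k + 1 ∧ j₂ ≠ k ∧ j₂ ≠ k + 1 := by
  by_cases h₀ : j₁ ≠ 0 ∧ j₁ ≠ 1 ∧ j₂ ≠ 0 ∧ j₂ ≠ 1
  · exact ⟨0, by grind⟩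
  by_cases h₁ : j₁ ≠ 2 ∧ j₁ ≠ 3 ∧ j₂ ≠ 2 ∧ j₂ ≠ 3
  · exact ⟨2, by omega, by omega⟩
  · exact ⟨4, by omega, by omega⟩

lemma contract_lt {n k j : ℕ} (hk : k < n) (hj : j < n + 2) : contract k j < n := by
  unfold contract
  split_ifs <;> omega

lemma contract_ne {k i j : ℕ} (hi : i ≠ k) (hi' : i ≠ k + 1) (hj : j ≠ k) (hj' : j ≠ k + 1)
    (h : i ≠ j) : contract k i ≠ contract k j := by
  unfold contract
  split_ifs <;> omega

lemma TwoExtendable.add_two_cols {m n : ℕ} (hn : 5 ≤ n) (h : TwoExtendable m n) :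
    TwoExtendable m (n + 2) where
  hh i₁ hi₁ j₁ hj₁ i₂ hi₂ j₂ hj₂ hd := by
    obtain ⟨k, hk, e₁, e₂, hd'⟩ : ∃ k < n, j₁ ≠ k + 1 ∧ j₂ ≠ k + 1 ∧ (i₁ ≠ i₂ ∨
        (contract k j₁ ≠ contract k j₂ ∧ cyclicPred n (contract k j₁) ≠ contract k j₂ ∧
          cyclicPred n (contract k j₂) ≠ contract k j₁)) := by
      rcases hd with hd | hd
      · obtain ⟨k, hk, -, e₁, -, e₂⟩ := exists_two_untouched hn j₁ j₂
        exact ⟨k, hk, e₁, e₂, Or.inl hd⟩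
      · obtain ⟨k, hk, e₁, e₂, hd'⟩ := exists_insertCols_hh hn hj₁ hj₂ hd
        exact ⟨k, hk, e₁, e₂, Or.inr hd'⟩
    obtain ⟨T, t₁, t₂⟩ := h.hh i₁ hi₁ _ (contract_lt hk hj₁) i₂ hi₂ _ (contract_lt hk hj₂) hd'
    exact ⟨T.insertCols k hk.le, by rwa [insertCols_H _ _ _ e₁], by rwa [insertCols_H _ _ _ e₂]⟩
  hv i₁ hi₁ j₁ hj₁ i₂ hi₂ j₂ hj₂ h0 hd := by
    obtain ⟨k, hk, e₁, e₂, e₃, hd'⟩ : ∃ k < n, j₁ ≠ k + 1 ∧ j₂ ≠ k ∧ j₂ ≠ k + 1 ∧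
        ((i₁ ≠ i₂ ∧ i₁ + 1 ≠ i₂) ∨
          (contract k j₁ ≠ contract k j₂ ∧ cyclicPred n (contract k j₁) ≠ contract k j₂)) := by
      rcases hd with hd | hd
      · obtain ⟨k, hk, -, e₁, e₂, e₃⟩ := exists_two_untouched hn j₁ j₂
        exact ⟨k, hk, e₁, e₂, e₃, Or.inl hd⟩
      · obtain ⟨k, hk, e₁, e₂, e₃, hd'⟩ := exists_insertCols_hv hn hj₂ hd
        exact ⟨k, hk, e₁, e₂, e₃, Or.inr hd'⟩
    obtain ⟨T, t₁, t₂⟩ := h.hv i₁ hi₁ _ (contract_lt hk hj₁) i₂ hi₂ _ (contract_lt hk hj₂) h0 hd'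
    exact ⟨T.insertCols k hk.le, by rwa [insertCols_H _ _ _ e₁],
      by rwa [insertCols_V _ _ _ e₂ e₃]⟩
  vv i₁ hi₁ j₁ hj₁ i₂ hi₂ j₂ hj₂ h0 h0' hd := by
    obtain ⟨k, hk, e₁, e₂, e₃, e₄⟩ := exists_two_untouched hn j₁ j₂
    obtain ⟨T, t₁, t₂⟩ := h.vv i₁ hi₁ _ (contract_lt hk hj₁) i₂ hi₂ _ (contract_lt hk hj₂) h0 h0'
      (hd.imp_left (contract_ne e₁ e₂ e₃ e₄))
    exact ⟨T.insertCols k hk.le, by rwa [insertCols_V _ _ _ e₁ e₂],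
      by rwa [insertCols_V _ _ _ e₃ e₄]⟩

lemma exists_insertRows_hv {m : ℕ} (hm : 6 ≤ m) {i₁ i₂ : ℕ} (h₁ : i₁ < m + 2) (h₂ : i₂ < m + 2)
    (h0 : i₂ ≠ 0) :
    ∃ k ≤ m, i₁ ≠ k ∧ i₁ ≠ k + 1 ∧ i₂ ≠ k + 1 ∧ contract k i₁ < m ∧ contract k i₂ < m ∧
      contract k i₂ ≠ 0 ∧ (i₁ ≠ i₂ ∧ i₁ + 1 ≠ i₂ →
        contract k i₁ ≠ contract k i₂ ∧ contract k i₁ + 1 ≠ contract k i₂) := by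
  unfold contract
  have d₁ : i₁ = 0 ∨ i₁ = 1 ∨ i₁ = 2 ∨ i₁ = 3 ∨ i₁ = 4 ∨ 5 ≤ i₁ := by omega
  have d₂ : i₂ = 1 ∨ i₂ = 2 ∨ i₂ = 3 ∨ i₂ = 4 ∨ i₂ = 5 ∨ 6 ≤ i₂ := by omega
  rcases d₁ with d₁ | d₁ | d₁ | d₁ | d₁ | d₁ <;>
  rcases d₂ with d₂ | d₂ | d₂ | d₂ | d₂ | d₂ <;>
  first
  | exact ⟨0, by omega, by grind⟩
  | exact ⟨1, by omega, by grind⟩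
  | exact ⟨2, by omega, by grind⟩
  | exact ⟨3, by omega, by grind⟩
  | exact ⟨4, by omega, by grind⟩
  | exact ⟨5, by omega, by grind⟩

lemma exists_insertRows_vv {m : ℕ} (hm : 6 ≤ m) {i₁ i₂ : ℕ} (h₁ : i₁ < m + 2) (h₂ : i₂ < m + 2)
    (h0 : i₁ ≠ 0) (h0' : i₂ ≠ 0) :
    ∃ k ≤ m, i₁ ≠ k + 1 ∧ i₂ ≠ k + 1 ∧ contract k i₁ < m ∧ contract k i₂ < m ∧
      contract k i₁ ≠ 0 ∧ contract k i₂ ≠ 0 ∧ (i₁ ≠ i₂ ∧ i₁ + 1 ≠ i₂ ∧ i₂ + 1 ≠ i₁ →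
        contract k i₁ ≠ contract k i₂ ∧ contract k i₁ + 1 ≠ contract k i₂ ∧
          contract k i₂ + 1 ≠ contract k i₁) := by
  unfold contract
  have d₁ : i₁ = 1 ∨ i₁ = 2 ∨ i₁ = 3 ∨ i₁ = 4 ∨ i₁ = 5 ∨ 6 ≤ i₁ := by omega
  have d₂ : i₂ = 1 ∨ i₂ = 2 ∨ i₂ = 3 ∨ i₂ = 4 ∨ i₂ = 5 ∨ 6 ≤ i₂ := by omega
  rcases d₁ with d₁ | d₁ | d₁ | d₁ | d₁ | d₁ <;>
  rcases d₂ with d₂ | d₂ | d₂ | d₂ | d₂ | d₂ <;>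
  first
  | exact ⟨0, by omega, by grind⟩
  | exact ⟨1, by omega, by grind⟩
  | exact ⟨2, by omega, by grind⟩
  | exact ⟨3, by omega, by grind⟩
  | exact ⟨4, by omega, by grind⟩
  | exact ⟨5, by omega, by grind⟩

lemma TwoExtendable.add_two_rows {m n : ℕ} (hm : 6 ≤ m) (h : TwoExtendable m n) :
    TwoExtendable (m + 2) n where
  hh i₁ hi₁ j₁ hj₁ i₂ hi₂ j₂ hj₂ hd := by
    obtain ⟨k, hk, e₁, e₂, e₃, e₄⟩ := exists_two_untouched (by omega : 5 ≤ m) i₁ i₂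
    obtain ⟨T, t₁, t₂⟩ := h.hh _ (contract_lt hk hi₁) j₁ hj₁ _ (contract_lt hk hi₂) j₂ hj₂
      (hd.imp_left (contract_ne e₁ e₂ e₃ e₄))
    exact ⟨T.insertRows k hk.le, by rwa [insertRows_H _ _ _ e₁ e₂],
      by rwa [insertRows_H _ _ _ e₃ e₄]⟩
  hv i₁ hi₁ j₁ hj₁ i₂ hi₂ j₂ hj₂ h0 hd := by
    obtain ⟨k, hk, e₁, e₂, e₃, l₁, l₂, h0', hd'⟩ := exists_insertRows_hv hm hi₁ hi₂ h0
    obtain ⟨T, t₁, t₂⟩ := h.hv _ l₁ j₁ hj₁ _ l₂ j₂ hj₂ h0' (hd.imp_left hd')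
    exact ⟨T.insertRows k hk, by rwa [insertRows_H _ _ _ e₁ e₂], by rwa [insertRows_V _ _ _ e₃]⟩
  vv i₁ hi₁ j₁ hj₁ i₂ hi₂ j₂ hj₂ h0 h0' hd := by
    obtain ⟨k, hk, e₁, e₂, l₁, l₂, z₁, z₂, hd'⟩ := exists_insertRows_vv hm hi₁ hi₂ h0 h0'
    obtain ⟨T, t₁, t₂⟩ := h.vv _ l₁ j₁ hj₁ _ l₂ j₂ hj₂ z₁ z₂ (hd.imp_right hd')
    exact ⟨T.insertRows k hk, by rwa [insertRows_V _ _ _ e₁], by rwa [insertRows_V _ _ _ e₂]⟩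

theorem twoExtendable {m n : ℕ} (hm : 4 ≤ m) (hme : Even m) (hn : 5 ≤ n) (hno : Odd n) :
    TwoExtendable m n := by
  have hrows : ∀ l, TwoExtendable (6 + 2 * l) 5 := fun l => by
    induction l with
    | zero => exact twoExtendable_six_five
    | succ l ih => exact ih.add_two_rows (Nat.le_add_right 6 _)
  have hbase : TwoExtendable m 5 := by
    obtain rfl | hm' := hm.eq_or_lt
    · exact twoExtendable_four_five
    · obtain ⟨c, rfl⟩ := hme
      obtain ⟨l, rfl⟩ : ∃ l, c = 3 + l := ⟨c - 3, by omega⟩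
      convert hrows l using 1
      ring
  have hcols : ∀ l, TwoExtendable m (5 + 2 * l) := fun l => by
    induction l with
    | zero => exact hbase
    | succ l ih => exact ih.add_two_cols (Nat.le_add_right 5 _)
  obtain ⟨c, rfl⟩ := hno
  obtain ⟨l, rfl⟩ : ∃ l, c = 2 + l := ⟨c - 2, by omega⟩
  convert hcols l using 1
  ring

lemma val_sub_one {n : ℕ} [NeZero n] (j : ZMod n) : (j - 1).val = cyclicPred n j.val := by
  have hj := ZMod.val_lt j
  have hn : 1 ≤ n := NeZero.one_le
  have hcast : j - 1 = (cyclicPred n j.val : ZMod n) := by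
    unfold cyclicPred
    split_ifs with h
    · rw [(ZMod.val_eq_zero j).mp h, Nat.cast_sub hn]
      simp
    · rw [Nat.cast_sub (Nat.one_le_iff_ne_zero.mpr h)]
      simp
  rw [hcast, ZMod.val_natCast_of_lt]
  unfold cyclicPred
  split_ifs <;> omega

lemma H_val_add_one {m n : ℕ} [NeZero n] (T : CylinderTiling m n) (i : ℕ) (j : ZMod n) :
    T.H i (j + 1).val = T.H i (j.val + 1) := by
  have hj := ZMod.val_lt j
  have h := val_sub_one (j + 1)
  rw [add_sub_cancel_right] at h
  unfold cyclicPred at h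
  split_ifs at h with h0
  · rw [h0, T.wrap]
    congr 1
    omega
  · congr 1
    omega

/-- The dominoes of a tiling, as edges between elements of `Fin m × ZMod n`. -/
def edges {m n : ℕ} (T : CylinderTiling m n) : Set (Sym2 (Fin m × ZMod n)) :=
  {e | (∃ i j, T.H i.val j.val = true ∧ e = s((i, j - 1), (i, j))) ∨
    ∃ i i' j, i'.val = i.val + 1 ∧ T.V i'.val j.val = true ∧ e = s((i, j), (i', j))}

lemma eq_of_mem_edges {m n : ℕ} [NeZero n] (T : CylinderTiling m n) {e f : Sym2 (Fin m × ZMod n)}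
    (he : e ∈ T.edges) (hf : f ∈ T.edges) {v : Fin m × ZMod n} (hve : v ∈ e) (hvf : v ∈ f) :
    e = f := by
  obtain ⟨i, j⟩ := v
  have key : ∀ e ∈ T.edges, (i, j) ∈ e →
      (T.H i.val j.val = true ∧ e = s((i, j - 1), (i, j))) ∨
      (T.H i.val (j.val + 1) = true ∧ e = s((i, j), (i, j + 1))) ∨
      (T.V i.val j.val = true ∧ ∃ i' : Fin m, i.val = i'.val + 1 ∧ e = s((i', j), (i, j))) ∨
      (T.V (i.val + 1) j.val = true ∧
        ∃ i' : Fin m, i'.val = i.val + 1 ∧ e = s((i, j), (i', j))) := by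
    rintro e (⟨a, b, h, rfl⟩ | ⟨a, a', b, ha, h, rfl⟩) hv <;>
    rw [Sym2.mem_iff, Prod.mk.injEq, Prod.mk.injEq] at hv <;>
    obtain ⟨rfl, rfl⟩ | ⟨rfl, rfl⟩ := hv
    · refine Or.inr (Or.inl ⟨?_, ?_⟩)
      · rw [← H_val_add_one, sub_add_cancel, h]
      · rw [sub_add_cancel]
    · exact Or.inl ⟨h, rfl⟩
    · exact Or.inr (Or.inr (Or.inr ⟨ha ▸ h, a', ha, rfl⟩))
    · exact Or.inr (Or.inr (Or.inl ⟨h, a, ha, rfl⟩))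
  have hc := T.cover i.val i.isLt j.val (ZMod.val_lt j)
  rcases key e he hve with ⟨h, rfl⟩ | ⟨h, rfl⟩ | ⟨h, a, ha, rfl⟩ | ⟨h, a, ha, rfl⟩ <;>
  rcases key f hf hvf with ⟨h', rfl⟩ | ⟨h', rfl⟩ | ⟨h', b, hb, rfl⟩ | ⟨h', b, hb, rfl⟩ <;>
  first
  | rfl
  | (obtain rfl : a = b := Fin.ext (by omega)
     rfl)
  | (rw [h, h'] at hc
     simp only [Bool.toNat_true] at hc
     omega)

lemma exists_mem_edges {m n : ℕ} [NeZero n] (T : CylinderTiling m n) (v : Fin m × ZMod n) :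
    ∃ e ∈ T.edges, v ∈ e := by
  obtain ⟨i, j⟩ := v
  have hc := T.cover i.val i.isLt j.val (ZMod.val_lt j)
  by_cases h₁ : T.H i.val j.val = true
  · exact ⟨s((i, j - 1), (i, j)), Or.inl ⟨i, j, h₁, rfl⟩, by simp⟩
  by_cases h₂ : T.H i.val (j.val + 1) = true
  · refine ⟨s((i, j + 1 - 1), (i, j + 1)), Or.inl ⟨i, j + 1, ?_, rfl⟩, by simp⟩
    rw [H_val_add_one, h₂]
  by_cases h₃ : T.V i.val j.val = true
  · have h0 : i.val ≠ 0 := fun h0 => by simp [h0, T.top] at h₃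
    exact ⟨s((⟨i.val - 1, by omega⟩, j), (i, j)),
      Or.inr ⟨_, i, j, by simp only; omega, h₃, rfl⟩, by simp⟩
  by_cases h₄ : T.V (i.val + 1) j.val = true
  · have hlt : i.val + 1 < m := lt_of_le_of_ne i.isLt fun h0 => by simp [h0, T.bot] at h₄
    exact ⟨s((i, j), (⟨i.val + 1, hlt⟩, j)), Or.inr ⟨i, _, j, rfl, h₄, rfl⟩, by simp⟩
  simp [h₁, h₂, h₃, h₄] at hc

lemma mem_edgeSet_iff {m n : ℕ} (hn : 2 ≤ n) (e : Sym2 (Fin m × ZMod n)) :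
    e ∈ (pathGraph m □ cycleZMod n).edgeSet ↔ (∃ i j, e = s((i, j - 1), (i, j))) ∨
      ∃ i i' j, i'.val = i.val + 1 ∧ e = s((i, j), (i', j)) := by
  have : Fact (1 < n) := ⟨hn⟩
  constructor
  · induction e using Sym2.ind with | _ x y
    obtain ⟨i, j⟩ := x
    obtain ⟨i', j'⟩ := y
    rw [mem_edgeSet, boxProd_adj, pathGraph_adj, cycleZMod, fromRel_adj]
    rintro (⟨h | h, rfl : j = j'⟩ | ⟨⟨-, h | h⟩, rfl : i = i'⟩)
    · exact Or.inr ⟨i, i', j, h.symm, rfl⟩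
    · exact Or.inr ⟨i', i, j, h.symm, Sym2.eq_swap⟩
    · exact Or.inl ⟨i, j', by simp_all⟩
    · exact Or.inl ⟨i, j, by simp_all [Sym2.eq_swap]⟩
  · rintro (⟨i, j, rfl⟩ | ⟨i, i', j, h, rfl⟩)
    · simp [boxProd_adj, cycleZMod]
    · simp [boxProd_adj, pathGraph_adj, h]

lemma isPerfectMatchingSet_edges {m n : ℕ} (hn : 2 ≤ n) (T : CylinderTiling m n) :
    IsPerfectMatchingSet (pathGraph m □ cycleZMod n) T.edges := by
  have : NeZero n := ⟨by omega⟩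
  refine ⟨⟨?_, fun e he f hf hne v hve hvf => hne (T.eq_of_mem_edges he hf hve hvf)⟩,
    T.exists_mem_edges⟩
  rintro e (⟨i, j, -, rfl⟩ | ⟨i, i', j, h, -, rfl⟩)
  · exact (mem_edgeSet_iff hn _).mpr (Or.inl ⟨i, j, rfl⟩)
  · exact (mem_edgeSet_iff hn _).mpr (Or.inr ⟨i, i', j, h, rfl⟩)

lemma TwoExtendable.exists_edges {m n : ℕ} (hn : 2 ≤ n) (h : TwoExtendable m n)
    {e f : Sym2 (Fin m × ZMod n)} (he : e ∈ (pathGraph m □ cycleZMod n).edgeSet)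
    (hf : f ∈ (pathGraph m □ cycleZMod n).edgeSet) (hef : ∀ v, v ∈ e → v ∉ f) :
    ∃ T : CylinderTiling m n, e ∈ T.edges ∧ f ∈ T.edges := by
  have : NeZero n := ⟨by omega⟩
  have hval : ∀ a b : ZMod n, a = b ↔ a.val = b.val := fun a b =>
    (ZMod.val_injective n).eq_iff.symm
  rcases (mem_edgeSet_iff hn e).mp he with ⟨i₁, j₁, rfl⟩ | ⟨i₁, i₁', j₁, h₁, rfl⟩ <;>
  rcases (mem_edgeSet_iff hn f).mp hf with ⟨i₂, j₂, rfl⟩ | ⟨i₂, i₂', j₂, h₂, rfl⟩ <;>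
  have hA := hef _ (Sym2.mem_mk_left _ _) <;>
  have hB := hef _ (Sym2.mem_mk_right _ _) <;>
  simp only [Sym2.mem_iff, Prod.mk.injEq, Fin.ext_iff, hval, val_sub_one] at hA hB
  · obtain ⟨T, t₁, t₂⟩ := h.hh i₁ i₁.isLt j₁.val (ZMod.val_lt j₁) i₂ i₂.isLt j₂.val
      (ZMod.val_lt j₂) (by omega)
    exact ⟨T, Or.inl ⟨i₁, j₁, t₁, rfl⟩, Or.inl ⟨i₂, j₂, t₂, rfl⟩⟩
  · obtain ⟨T, t₁, t₂⟩ := h.hv i₁ i₁.isLt j₁.val (ZMod.val_lt j₁) i₂' i₂'.isLt j₂.val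
      (ZMod.val_lt j₂) (by omega) (by omega)
    exact ⟨T, Or.inl ⟨i₁, j₁, t₁, rfl⟩, Or.inr ⟨i₂, i₂', j₂, h₂, t₂, rfl⟩⟩
  · obtain ⟨T, t₂, t₁⟩ := h.hv i₂ i₂.isLt j₂.val (ZMod.val_lt j₂) i₁' i₁'.isLt j₁.val
      (ZMod.val_lt j₁) (by omega) (by omega)
    exact ⟨T, Or.inr ⟨i₁, i₁', j₁, h₁, t₁, rfl⟩, Or.inl ⟨i₂, j₂, t₂, rfl⟩⟩
  · obtain ⟨T, t₁, t₂⟩ := h.vv i₁' i₁'.isLt j₁.val (ZMod.val_lt j₁) i₂' i₂'.isLt j₂.val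
      (ZMod.val_lt j₂) (by omega) (by omega) (by omega)
    exact ⟨T, Or.inr ⟨i₁, i₁', j₁, h₁, t₁, rfl⟩, Or.inr ⟨i₂, i₂', j₂, h₂, t₂, rfl⟩⟩

end CylinderTiling

/-- For even `m ≥ 4` and odd `n ≥ 5`, the Cartesian product
`P_m × C_n` is `2`-extendable. -/
theorem pathGraph_boxProd_cycle_two_extendable (m n : ℕ) (hm : 4 ≤ m) (hme : Even m)
    (hn : 5 ≤ n) (hno : Odd n) :
    Extendable (SimpleGraph.pathGraph m □ cycleZMod n) 2 := by
  have h := CylinderTiling.twoExtendable hm hme hn hno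
  have hn2 : 2 ≤ n := by omega
  constructor
  · obtain ⟨T, -⟩ := h.hh 0 (by omega) 0 (by omega) 1 (by omega) 0 (by omega) (by omega)
    exact ⟨T.edges, T.isPerfectMatchingSet_edges hn2⟩
  · intro M hM hcard
    obtain ⟨e, f, hne, rfl⟩ := Set.ncard_eq_two.mp hcard
    obtain ⟨T, he, hf⟩ := h.exists_edges hn2 (hM.1 (by simp)) (hM.1 (by simp))
      (hM.2 (Set.mem_insert e {f}) (by simp) hne)
    exact ⟨T.edges, T.isPerfectMatchingSet_edges hn2, by simp [Set.insert_subset_iff, he, hf]⟩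
end

section
/- Let m ≥ 6 be an even integer and let n ≥ 5 be an odd integer. Then the Cartesian product graph C_m × C_n is 3-extendable. -/
open SimpleGraph

namespace TorusMatching

variable {m n : ℕ}

/-- Directed edges of the torus grid `C_m × C_n`: a starting point together with a direction,
`false` increasing the first coordinate and `true` increasing the second one. -/
abbrev Arc (m n : ℕ) := (ZMod m × ZMod n) × Bool

/-- The end point of an arc. -/
def Arc.tgt (e : Arc m n) : ZMod m × ZMod n :=
  if e.2 then (e.1.1, e.1.2 + 1) else (e.1.1 + 1, e.1.2)

/-- Two arcs without a common end point. -/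
def Arc.Disj (e f : Arc m n) : Prop :=
  e.1 ≠ f.1 ∧ e.1 ≠ f.tgt ∧ e.tgt ≠ f.1 ∧ e.tgt ≠ f.tgt

instance (e f : Arc m n) : Decidable (e.Disj f) := by unfold Arc.Disj; infer_instance

/-- Perfect matchings of the torus grid as Boolean functions on arcs: each vertex lies on exactly
one selected arc. -/
def IsTiling (T : Arc m n → Bool) : Prop :=
  ∀ p : ZMod m × ZMod n, (T (p, false)).toNat + (T (p - (1, 0), false)).toNat +
    (T (p, true)).toNat + (T (p - (0, 1), true)).toNat = 1

instance [NeZero m] [NeZero n] (T : Arc m n → Bool) : Decidable (IsTiling T) := by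
  unfold IsTiling; infer_instance

/-- Three arcs lie in a common perfect matching. -/
def Extends (e f g : Arc m n) : Prop :=
  ∃ T, IsTiling T ∧ T e = true ∧ T f = true ∧ T g = true

/-- Any three pairwise disjoint arcs lie in a common perfect matching. -/
def ThreeExtendable (m n : ℕ) : Prop :=
  ∀ e f g : Arc m n, e.Disj f → e.Disj g → f.Disj g → Extends e f g

/-- The translate of an arc. -/
def shift (c : ZMod m × ZMod n) (e : Arc m n) : Arc m n := (e.1 + c, e.2)

/-- The mirror image of an arc under exchange of the coordinates. -/
def swap (e : Arc m n) : Arc n m := (e.1.swap, !e.2)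

theorem shift_tgt (c : ZMod m × ZMod n) (e : Arc m n) : (shift c e).tgt = e.tgt + c := by
  obtain ⟨⟨x, y⟩, _ | _⟩ := e <;> simp [shift, Arc.tgt, Prod.ext_iff] <;> ring

theorem swap_tgt (e : Arc m n) : (swap e).tgt = e.tgt.swap := by
  obtain ⟨⟨x, y⟩, _ | _⟩ := e <;> simp [swap, Arc.tgt]

theorem Arc.Disj.shift {e f : Arc m n} (h : e.Disj f) (c : ZMod m × ZMod n) :
    (shift c e).Disj (shift c f) := by
  unfold Arc.Disj at *
  simp only [shift_tgt]
  simpa only [TorusMatching.shift, ne_eq, add_left_inj] using h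

theorem Arc.Disj.swap {e f : Arc m n} (h : e.Disj f) : (swap e).Disj (swap f) := by
  unfold Arc.Disj at *
  simp only [swap_tgt]
  simpa only [TorusMatching.swap, ne_eq, Prod.swap_inj] using h

theorem Extends.of_shift {e f g : Arc m n} (c : ZMod m × ZMod n)
    (h : Extends (shift c e) (shift c f) (shift c g)) : Extends e f g := by
  obtain ⟨T, hT, h⟩ := h
  refine ⟨fun a => T (shift c a), fun p => ?_, h⟩
  have := hT (p + c)
  simpa only [shift, sub_add_eq_add_sub] using this

theorem Extends.of_swap {e f g : Arc m n} (h : Extends (swap e) (swap f) (swap g)) :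
    Extends e f g := by
  obtain ⟨T, hT, h⟩ := h
  refine ⟨fun a => T (swap a), fun p => ?_, h⟩
  have := hT p.swap
  simp only [swap, Prod.swap_sub, Prod.swap_prod_mk, Bool.not_true, Bool.not_false] at this ⊢
  omega

theorem ThreeExtendable.swap (h : ThreeExtendable m n) : ThreeExtendable n m :=
  fun _ _ _ hef heg hfg => (h _ _ _ hef.swap heg.swap hfg.swap).of_swap

theorem ThreeExtendable.of_zero
    (h : ∀ d (f g : Arc m n), Arc.Disj (0, d) f → Arc.Disj (0, d) g → f.Disj g →
      Extends (0, d) f g) : ThreeExtendable m n := by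
  intro e f g hef heg hfg
  apply Extends.of_shift (-e.1)
  have h0 : shift (-e.1) e = (0, e.2) := by simp [shift]
  have h1 := hef.shift (-e.1)
  have h2 := heg.shift (-e.1)
  rw [h0] at h1 h2 ⊢
  exact h _ _ _ h1 h2 (hfg.shift _)

/-- An arc starting at level `y`, which rises by one level if `d` holds, meets neither of the
levels `r` and `r + 1`. -/
def Avoids (r y : ZMod n) (d : Bool) : Prop :=
  y ≠ r ∧ y ≠ r + 1 ∧ (d = true → y + 1 ≠ r)

instance (r y : ZMod n) (d : Bool) : Decidable (Avoids r y d) := by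
  unfold Avoids; infer_instance

/-- Inserting two new last rows into a perfect matching. -/
def insertRows (T : Arc m n → Bool) : Arc m (n + 2) → Bool := fun e =>
  if e.1.2.val < n then T ((e.1.1, (e.1.2.val : ZMod n)), e.2)
  else if e.2 then xor (decide (e.1.2.val = n)) (T ((e.1.1, -1), true)) else false

theorem val_sub_one (y : ZMod (n + 2)) :
    (y - 1).val = if y.val = 0 then n + 1 else y.val - 1 := by
  split_ifs with h
  · rw [(ZMod.val_eq_zero y).1 h, zero_sub, ZMod.val_neg_one]
  · rw [ZMod.val_sub] <;> rw [ZMod.val_one'' (by omega)]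
    omega

theorem isTiling_insertRows [NeZero n] {T : Arc m n → Bool} (hT : IsTiling T) :
    IsTiling (insertRows T) := by
  rintro ⟨x, y⟩
  have hn : n ≠ 0 := NeZero.ne n
  have hy : y.val < n + 2 := ZMod.val_lt y
  have key := hT (x, (y.val : ZMod n))
  simp only [insertRows, Prod.mk_sub_mk, sub_zero, val_sub_one] at key ⊢
  rcases Nat.lt_or_ge y.val n with h | h
  · rcases Nat.eq_zero_or_pos y.val with h0 | h0
    · have h1 : ¬ n + 1 < n := by omega
      simp [h0, h1, Nat.pos_of_ne_zero hn] at key ⊢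
      exact key
    · have h1 : y.val ≠ 0 := by omega
      have h2 : y.val - 1 < n := by omega
      have h3 : ((y.val - 1 : ℕ) : ZMod n) = (y.val : ZMod n) - 1 := by
        rw [Nat.cast_sub h0, Nat.cast_one]
      simp only [h, h1, h2, h3, if_true, if_false]
      exact key
  · have h1 : y.val ≠ 0 := by omega
    rcases Nat.lt_or_ge n y.val with h2 | h2
    · have h3 : y.val = n + 1 := by omega
      simp [h3]
      cases T ((x, -1), true) <;> rfl
    · have h3 : y.val = n := by omega
      have h4 : n - 1 < n := by omega
      have h5 : ((n - 1 : ℕ) : ZMod n) = -1 := by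
        rw [Nat.cast_sub (by omega), Nat.cast_one, ZMod.natCast_self, zero_sub]
      simp [h3, hn, h4, h5]
      cases T ((x, -1), true) <;> rfl

/-- Deleting the last two rows. -/
def deleteRows (p : ZMod m × ZMod (n + 2)) : ZMod m × ZMod n := (p.1, (p.2.val : ZMod n))

theorem val_lt_of_avoids {y : ZMod (n + 2)} {d : Bool} (h : Avoids (n : ZMod (n + 2)) y d) :
    y.val < n ∧ (d = true → (y + 1).val = y.val + 1 ∧ y.val + 1 < n) := by
  obtain ⟨h1, h2, h3⟩ := h
  have hv : ((y.val : ℕ) : ZMod (n + 2)) = y := ZMod.natCast_zmod_val y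
  have hy : y.val < n + 2 := ZMod.val_lt y
  have h4 : y.val ≠ n := fun h => h1 (by rw [← hv, h])
  have h5 : y.val ≠ n + 1 := fun h => h2 (by rw [← hv, h]; push_cast; rfl)
  refine ⟨by omega, fun hd => ⟨?_, ?_⟩⟩
  · rw [ZMod.val_add_of_lt] <;> rw [ZMod.val_one'' (by omega)]
    omega
  · have h6 : y.val + 1 ≠ n := fun h => h3 hd (by rw [← hv, ← Nat.cast_succ]; exact congrArg _ h)
    omega

theorem deleteRows_tgt {e : Arc m (n + 2)} (h : Avoids (n : ZMod (n + 2)) e.1.2 e.2) :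
    Arc.tgt (deleteRows e.1, e.2) = deleteRows e.tgt := by
  obtain ⟨⟨x, y⟩, _ | _⟩ := e
  · simp [Arc.tgt, deleteRows]
  · simp [Arc.tgt, deleteRows, ((val_lt_of_avoids h).2 rfl).1]

theorem val_tgt_lt {e : Arc m (n + 2)} (h : Avoids (n : ZMod (n + 2)) e.1.2 e.2) :
    e.tgt.2.val < n := by
  obtain ⟨⟨x, y⟩, _ | _⟩ := e
  · exact (val_lt_of_avoids h).1
  · have := (val_lt_of_avoids h).2 rfl
    dsimp only [Arc.tgt, if_true] at this ⊢
    simp only [if_true]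
    omega

theorem deleteRows_ne {p q : ZMod m × ZMod (n + 2)} (hp : p.2.val < n) (hq : q.2.val < n)
    (h : p ≠ q) : deleteRows p ≠ deleteRows q := by
  intro h'
  apply h
  simp only [deleteRows, Prod.mk.injEq] at h'
  refine Prod.ext h'.1 (ZMod.val_injective _ ?_)
  rw [← ZMod.val_cast_of_lt hp, h'.2, ZMod.val_cast_of_lt hq]

theorem Arc.Disj.deleteRows {e f : Arc m (n + 2)} (h : e.Disj f)
    (he : Avoids (n : ZMod (n + 2)) e.1.2 e.2) (hf : Avoids (n : ZMod (n + 2)) f.1.2 f.2) :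
    Arc.Disj (deleteRows e.1, e.2) (deleteRows f.1, f.2) := by
  have h1 := (val_lt_of_avoids he).1
  have h2 := (val_lt_of_avoids hf).1
  have h3 := val_tgt_lt he
  have h4 := val_tgt_lt hf
  unfold Arc.Disj
  rw [deleteRows_tgt he, deleteRows_tgt hf]
  exact ⟨deleteRows_ne h1 h2 h.1, deleteRows_ne h1 h4 h.2.1, deleteRows_ne h3 h2 h.2.2.1,
    deleteRows_ne h3 h4 h.2.2.2⟩

theorem insertRows_apply {T : Arc m n → Bool} {e : Arc m (n + 2)} (h : e.1.2.val < n) :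
    insertRows T e = T (deleteRows e.1, e.2) := by
  simp [insertRows, deleteRows, h]

theorem avoids_shift {r y : ZMod n} {d : Bool} (h : Avoids r y d) (c : ZMod n) :
    Avoids (r + c) (y + c) d := by
  obtain ⟨h1, h2, h3⟩ := h
  refine ⟨by simpa using h1, fun h => h2 ?_, fun hd h => h3 hd ?_⟩
  · linear_combination h
  · linear_combination h

/-- Three arcs avoiding two consecutive rows extend if the torus with two rows fewer is
`3`-extendable. -/
theorem ThreeExtendable.extends_of_rows [NeZero n] (H : ThreeExtendable m n)
    {e f g : Arc m (n + 2)} (hef : e.Disj f) (heg : e.Disj g) (hfg : f.Disj g)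
    {r : ZMod (n + 2)} (he : Avoids r e.1.2 e.2) (hf : Avoids r f.1.2 f.2)
    (hg : Avoids r g.1.2 g.2) : Extends e f g := by
  set c : ZMod m × ZMod (n + 2) := (0, n - r)
  have hr : r + (n - r) = (n : ZMod (n + 2)) := by ring
  have key : ∀ a : Arc m (n + 2), Avoids r a.1.2 a.2 →
      Avoids (n : ZMod (n + 2)) (shift c a).1.2 (shift c a).2 := fun a ha => by
    have := avoids_shift ha (n - r)
    rwa [hr] at this
  apply Extends.of_shift c
  have he' := key e he
  have hf' := key f hf
  have hg' := key g hg
  obtain ⟨T, hT, h1, h2, h3⟩ := H _ _ _ ((hef.shift c).deleteRows he' hf')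
    ((heg.shift c).deleteRows he' hg') ((hfg.shift c).deleteRows hf' hg')
  refine ⟨insertRows T, isTiling_insertRows hT, ?_, ?_, ?_⟩
  · rwa [insertRows_apply (val_lt_of_avoids he').1]
  · rwa [insertRows_apply (val_lt_of_avoids hf').1]
  · rwa [insertRows_apply (val_lt_of_avoids hg').1]

/-- Three arcs avoiding two consecutive columns extend if the torus with two columns fewer is
`3`-extendable. -/
theorem ThreeExtendable.extends_of_columns [NeZero m] (H : ThreeExtendable m n)
    {e f g : Arc (m + 2) n} (hef : e.Disj f) (heg : e.Disj g) (hfg : f.Disj g)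
    {r : ZMod (m + 2)} (he : Avoids r e.1.1 (!e.2)) (hf : Avoids r f.1.1 (!f.2))
    (hg : Avoids r g.1.1 (!g.2)) : Extends e f g :=
  (H.swap.extends_of_rows hef.swap heg.swap hfg.swap he hf hg).of_swap

theorem exists_avoids (hn : 10 ≤ n) (y₁ y₂ y₃ : ZMod n) (d₁ d₂ d₃ : Bool) :
    ∃ r, Avoids r y₁ d₁ ∧ Avoids r y₂ d₂ ∧ Avoids r y₃ d₃ := by
  have : NeZero n := ⟨by omega⟩
  let s : Fin 9 → ZMod n :=
    ![y₁, y₁ - 1, y₁ + 1, y₂, y₂ - 1, y₂ + 1, y₃, y₃ - 1, y₃ + 1]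
  have hs : ¬ Function.Surjective s := fun h => by
    have := Fintype.card_le_of_surjective s h
    rw [ZMod.card, Fintype.card_fin] at this
    omega
  obtain ⟨r, hr⟩ := not_forall.1 hs
  rw [not_exists] at hr
  have key : ∀ y : ZMod n, ∀ d : Bool, y ≠ r → y - 1 ≠ r → y + 1 ≠ r → Avoids r y d :=
    fun y d h1 h2 h3 => ⟨h1, fun h => h2 (by rw [h]; ring), fun _ => h3⟩
  exact ⟨r, key _ _ (hr 0) (hr 1) (hr 2), key _ _ (hr 3) (hr 4) (hr 5),
    key _ _ (hr 6) (hr 7) (hr 8)⟩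

theorem ThreeExtendable.add_two_right (hn : 8 ≤ n) (H : ThreeExtendable m n) :
    ThreeExtendable m (n + 2) := by
  intro e f g hef heg hfg
  have : NeZero n := ⟨by omega⟩
  obtain ⟨r, he, hf, hg⟩ := exists_avoids (n := n + 2) (by omega) e.1.2 f.1.2 g.1.2 e.2 f.2 g.2
  exact H.extends_of_rows hef heg hfg he hf hg

theorem ThreeExtendable.add_two_left (hm : 8 ≤ m) (H : ThreeExtendable m n) :
    ThreeExtendable (m + 2) n :=
  (H.swap.add_two_right hm).swap

/-- The set of arcs encoded by the binary digits of `N`. -/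
def ofBits (N : ℕ) (e : Arc m n) : Bool :=
  N.testBit (2 * (e.1.1.val + m * e.1.2.val) + e.2.toNat)

/-- Every pair of consecutive levels is met by one of three arcs. -/
def Dense (y₁ y₂ y₃ : ZMod n) (d₁ d₂ d₃ : Bool) : Prop :=
  ∀ r, ¬ (Avoids r y₁ d₁ ∧ Avoids r y₂ d₂ ∧ Avoids r y₃ d₃)

instance [NeZero n] (y₁ y₂ y₃ : ZMod n) (d₁ d₂ d₃ : Bool) :
    Decidable (Dense y₁ y₂ y₃ d₁ d₂ d₃) := by
  unfold Dense; infer_instance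

/-- Each triple of pairwise disjoint arcs, the first starting at the origin, lies in one of the
listed sets; if `rows` (resp. `cols`) holds, only triples meeting any two consecutive
rows (resp. columns) are considered. -/
def Covers (m n : ℕ) (rows cols : Bool) (L : List ℕ) : Prop :=
  ∀ d₁ (y₂ : ZMod n) d₂ (y₃ : ZMod n) d₃, (rows = true → Dense 0 y₂ y₃ d₁ d₂ d₃) →
    ∀ x₂ : ZMod m, Arc.Disj (0, d₁) ((x₂, y₂), d₂) →
      ∀ x₃ : ZMod m, (cols = true → Dense 0 x₂ x₃ (!d₁) (!d₂) (!d₃)) →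
        Arc.Disj (0, d₁) ((x₃, y₃), d₃) → Arc.Disj ((x₂, y₂), d₂) ((x₃, y₃), d₃) →
          ∃ N ∈ L, ofBits N (((0, 0), d₁) : Arc m n) = true ∧
            ofBits N (((x₂, y₂), d₂) : Arc m n) = true ∧
              ofBits N (((x₃, y₃), d₃) : Arc m n) = true

instance [NeZero m] [NeZero n] (rows cols : Bool) (L : List ℕ) :
    Decidable (Covers m n rows cols L) := by
  unfold Covers; infer_instance

theorem ThreeExtendable.of_covers {rows cols : Bool} {L : List ℕ}
    (hL : ∀ N ∈ L, IsTiling (ofBits N : Arc m n → Bool)) (h : Covers m n rows cols L)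
    (hrows : rows = true → ∃ k, k ≠ 0 ∧ n = k + 2 ∧ ThreeExtendable m k)
    (hcols : cols = true → ∃ k, k ≠ 0 ∧ m = k + 2 ∧ ThreeExtendable k n) :
    ThreeExtendable m n := by
  apply ThreeExtendable.of_zero
  intro d f g hf hg hfg
  by_contra hne
  obtain ⟨N, hN, h1, h2, h3⟩ := h d f.1.2 f.2 g.1.2 g.2
    (fun hr r ⟨a1, a2, a3⟩ => by
      obtain ⟨k, hk, rfl, H⟩ := hrows hr
      have : NeZero k := ⟨hk⟩
      exact hne (H.extends_of_rows hf hg hfg a1 a2 a3))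
    f.1.1 hf g.1.1
    (fun hc r ⟨a1, a2, a3⟩ => by
      obtain ⟨k, hk, rfl, H⟩ := hcols hc
      have : NeZero k := ⟨hk⟩
      exact hne (H.extends_of_columns hf hg hfg a1 a2 a3))
    hg hfg
  exact hne ⟨ofBits N, hL N hN, h1, h2, h3⟩

/-- Perfect matchings of the `6 × 5` torus grid. -/
def tilings65 : List ℕ :=
  [18443277913317649, 73210311995326881, 292840085647333905, 603765036226879553,
   725365448101085201, 180568493287282721, 585864050917838913, 117112987525910785,
   288277140931088801, 469575307385677857, 19282298759944721, 76579480025737313,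
   603500636448768641, 72086868546199825, 117446559721079041, 289400361213536929,
   76917714624057617, 307389366712406433, 765912104577667073, 725081369949048849,
   45212625199530241, 18443212775561745, 4962181945235553, 603834479429161601,
   289400361234743569, 306322307480557665, 1310760266916113, 117375111090215425,
   603838885037884033, 117393830068120065, 720868522427682977, 585793717416509505,
   333303241536602369, 307370720370954513, 4961067878949137, 19285863517657185,
   4680211394204065, 18438906706149649, 76861447380146273, 721728645463281825,
   45494562441269505, 603835302301425729, 76580589807339626, 307375382960701830,
   468465253108358, 439175749384292370, 725431669368422426, 306265117885006106,
   117445462622011658, 11444146521409602, 317504916627147394, 585512655206285386,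
   468394708755040262, 73210299120880298, 4960999327138218, 180572880799631366,
   333373579122573578, 720886089699557546, 18443281076193818, 76843880108279878,
   181411885613320234, 307388355339978822, 83343393997996418, 306322294811396202,
   765894554260471818, 4680215678749210, 117450125277727242, 72069319317127450,
   72367661048416326, 725436056947671174, 307389436084486426, 1311047426787398,
   29414575368585602, 439119741536274450, 479652125312567298, 439105671256901794,
   76913340182593926, 603501730059125386, 288277140863093382, 11444147592792130,
   585864055203364938, 603782516920942666, 731861758298456194, 307370994644877594,
   76566313822603334, 307442168997364102, 434626038317090834, 306265117817995654,
   117392934610993418, 317521647270789506, 721711091931955334]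

/-- Perfect matchings of the `8 × 5` torus grid. -/
def tilings85 : List ℕ :=
  [115127300726769118875713, 625123554363017243788353, 633092565814784377357473,
   322375592595007597711633, 632872157256245016134673, 307255907096143355058273,
   190102948469327863578721, 322375317631719857825889, 83232004956706389526017,
   5047563549930011330209, 635748595261666517844993, 491131205556517914903057,
   303488720451079543817313, 78528514777561664917761, 331009605441582226768914,
   321416507986715096424730, 632872158382046130996250, 21869051949760411341066]

/-- Perfect matchings of the `6 × 7` torus grid. -/
def tilings67 : List ℕ :=
  [1289211419803133182847505, 12169612819647163336626193, 12844849128513938482335745,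
   1289206818325145545478417, 1215013396170427188142353, 78539626107548004008209,
   5137981608534724263809441, 1289280425197050848706833, 12095346060796287160189089,
   5157120617495721898152353, 12169543796353373545959585, 5157138948175184466614801,
   323558514400859727096337, 5139235305398850559217937, 5593062071734482057693706,
   12164846756436559046639786, 3029508782227072307857414, 304641530366141805953306,
   1213834527047406447757418, 1289280443101515404642374, 5156903175096766112071962,
   78539626107616569131290, 5025336395862968819007874, 10130661489634989270237834,
   12108593007352976685531162, 323484601463741863709318, 5157138965307622750292506,
   5025341015403869323152002, 2533552403554712053450770, 5139235305732693542961434,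
   12169853466765914747715718, 192000936170505140076930, 1398265518074066612797826,
   7878166573109890484029446, 5025337564240341253505410, 1290465116687034698975302,
   5138276107903989735620890, 5156844524395287569629466, 5327129262114070105964930,
   4837667933620081389079066, 10125079170526185181478986, 1290391433702948343122026,
   1969540425500447792499210]

/-- Perfect matchings of the `8 × 7` torus grid. -/
def tilings87 : List ℕ :=
  [2684984326709404512710470203089281, 325888334773069519906077533082017,
   1384596340534275050618310942265734, 812605518136781599600288125452934]

/-- Perfect matchings of the `6 × 9` torus grid. -/
def tilings69 : List ℕ :=
  [204170987692574086253836077367466, 21634240932309807236662767487046,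
   205995826643588326724128629489794]

theorem threeExtendable_six_five : ThreeExtendable 6 5 :=
  .of_covers (L := tilings65) (rows := false) (cols := false)
    (by decide +kernel) (by decide +kernel) (by simp) (by simp)

theorem threeExtendable_eight_five : ThreeExtendable 8 5 :=
  .of_covers (L := tilings85) (rows := false) (cols := true)
    (by decide +kernel) (by decide +kernel) (by simp)
    (fun _ => ⟨6, by decide, rfl, threeExtendable_six_five⟩)

theorem threeExtendable_six_seven : ThreeExtendable 6 7 :=
  .of_covers (L := tilings67) (rows := true) (cols := false)
    (by decide +kernel) (by decide +kernel)
    (fun _ => ⟨5, by decide, rfl, threeExtendable_six_five⟩) (by simp)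

theorem threeExtendable_eight_seven : ThreeExtendable 8 7 :=
  .of_covers (L := tilings87) (rows := true) (cols := true)
    (by decide +kernel) (by decide +kernel)
    (fun _ => ⟨5, by decide, rfl, threeExtendable_eight_five⟩)
    (fun _ => ⟨6, by decide, rfl, threeExtendable_six_seven⟩)

theorem threeExtendable_six_nine : ThreeExtendable 6 9 :=
  .of_covers (L := tilings69) (rows := true) (cols := false)
    (by decide +kernel) (by decide +kernel)
    (fun _ => ⟨7, by decide, rfl, threeExtendable_six_seven⟩) (by simp)

theorem threeExtendable_eight_nine : ThreeExtendable 8 9 :=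
  .of_covers (L := []) (rows := true) (cols := true)
    (by simp) (by decide +kernel)
    (fun _ => ⟨7, by decide, rfl, threeExtendable_eight_seven⟩)
    (fun _ => ⟨6, by decide, rfl, threeExtendable_six_nine⟩)

theorem ThreeExtendable.all_right (h5 : ThreeExtendable m 5) (h7 : ThreeExtendable m 7)
    (h9 : ThreeExtendable m 9) : ∀ k, ThreeExtendable m (2 * k + 5)
  | 0 => h5
  | 1 => h7
  | 2 => h9
  | k + 3 => (all_right h5 h7 h9 (k + 2)).add_two_right (by omega)

theorem threeExtendable_even_odd (k l : ℕ) : ThreeExtendable (2 * k + 6) (2 * l + 5) := by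
  induction k with
  | zero =>
    exact .all_right threeExtendable_six_five threeExtendable_six_seven
      threeExtendable_six_nine l
  | succ k ih =>
    cases k with
    | zero =>
      exact .all_right threeExtendable_eight_five threeExtendable_eight_seven
        threeExtendable_eight_nine l
    | succ k => exact ih.add_two_left (by omega)

/-- The undirected edge underlying an arc. -/
def Arc.edge (e : Arc m n) : Sym2 (ZMod m × ZMod n) := s(e.1, e.tgt)

theorem Arc.disj_of_edge {e f : Arc m n} (h : ∀ v, v ∈ e.edge → v ∉ f.edge) : e.Disj f := by
  have h1 := h e.1 (by simp [Arc.edge])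
  have h2 := h e.tgt (by simp [Arc.edge])
  simp only [Arc.edge, Sym2.mem_iff, not_or] at h1 h2
  exact ⟨h1.1, h1.2, h2.1, h2.2⟩

theorem exists_edge_eq {s : Sym2 (ZMod m × ZMod n)}
    (hs : s ∈ (cycleZMod m □ cycleZMod n).edgeSet) : ∃ e : Arc m n, e.edge = s := by
  induction s with | _ p q
  obtain ⟨x, y⟩ := p
  obtain ⟨x', y'⟩ := q
  simp only [SimpleGraph.mem_edgeSet, SimpleGraph.boxProd_adj, cycleZMod,
    SimpleGraph.fromRel_adj] at hs
  rcases hs with ⟨⟨-, h | h⟩, h'⟩ | ⟨⟨-, h | h⟩, h'⟩ <;> subst h h'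
  · exact ⟨((x, y), false), rfl⟩
  · exact ⟨((x', y), false), Sym2.eq_swap⟩
  · exact ⟨((x, y), true), rfl⟩
  · exact ⟨((x, y'), true), Sym2.eq_swap⟩

theorem edge_mem_edgeSet (hm : m ≠ 1) (hn : n ≠ 1) (e : Arc m n) :
    e.edge ∈ (cycleZMod m □ cycleZMod n).edgeSet := by
  have := ZMod.nontrivial_iff.2 hm
  have := ZMod.nontrivial_iff.2 hn
  obtain ⟨⟨x, y⟩, _ | _⟩ := e <;>
    simp [Arc.edge, Arc.tgt, SimpleGraph.boxProd_adj, cycleZMod]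

theorem eq_of_common_vertex {T : Arc m n → Bool} (hT : IsTiling T) {e f : Arc m n}
    (he : T e = true) (hf : T f = true) {v : ZMod m × ZMod n} (hve : v ∈ e.edge)
    (hvf : v ∈ f.edge) : e = f := by
  have key : ∀ a : Arc m n, v ∈ a.edge → a = (v, false) ∨ a = (v - (1, 0), false) ∨
      a = (v, true) ∨ a = (v - (0, 1), true) := by
    rintro ⟨⟨x, y⟩, _ | _⟩ h <;> simp only [Arc.edge, Arc.tgt, Sym2.mem_iff] at h <;>
      rcases h with rfl | rfl <;> simp
  have hv := hT v
  rcases key e hve with rfl | rfl | rfl | rfl <;> rcases key f hvf with rfl | rfl | rfl | rfl <;>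
    first
    | rfl
    | (exfalso; rw [he, hf] at hv; simp only [Bool.toNat_true] at hv; omega)

theorem isPerfectMatchingSet_image (hm : m ≠ 1) (hn : n ≠ 1) {T : Arc m n → Bool}
    (hT : IsTiling T) :
    IsPerfectMatchingSet (cycleZMod m □ cycleZMod n) (Arc.edge '' {e | T e = true}) := by
  refine ⟨⟨?_, ?_⟩, fun v => ?_⟩
  · rintro _ ⟨e, -, rfl⟩
    exact edge_mem_edgeSet hm hn e
  · rintro _ ⟨e, he, rfl⟩ _ ⟨f, hf, rfl⟩ hne v hve hvf
    exact hne (congrArg _ (eq_of_common_vertex hT he hf hve hvf))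
  · by_contra! h
    have h' : ∀ e : Arc m n, v ∈ e.edge → T e = false := fun e hv =>
      Bool.eq_false_iff.2 fun he => h _ ⟨e, he, rfl⟩ hv
    have hv := hT v
    rw [h' (v, false) (by simp [Arc.edge]), h' (v, true) (by simp [Arc.edge]),
      h' (v - (1, 0), false) (by simp [Arc.edge, Arc.tgt]),
      h' (v - (0, 1), true) (by simp [Arc.edge, Arc.tgt])] at hv
    simp at hv

theorem ThreeExtendable.extendable (hm : m ≠ 1) (hn : 3 ≤ n) (H : ThreeExtendable m n) :
    Extendable (cycleZMod m □ cycleZMod n) 3 := by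
  constructor
  · have cast_ne : ∀ i j : ℕ, i < n → j < n → i ≠ j → (i : ZMod n) ≠ j := fun i j hi hj hij h =>
      hij (by rw [← ZMod.val_cast_of_lt hi, h, ZMod.val_cast_of_lt hj])
    have key : ∀ i j : ℕ, i < n → j < n → i ≠ j →
        Arc.Disj (((0, (i : ZMod n)), false) : Arc m n) ((0, (j : ZMod n)), false) :=
      fun i j hi hj hij => by simp [Arc.Disj, Arc.tgt, cast_ne i j hi hj hij]
    obtain ⟨T, hT, -⟩ := H _ _ _ (key 0 1 (by omega) (by omega) (by omega))
      (key 0 2 (by omega) (by omega) (by omega)) (key 1 2 (by omega) (by omega) (by omega))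
    exact ⟨_, isPerfectMatchingSet_image hm (by omega) hT⟩
  · rintro M ⟨hM, hdisj⟩ hcard
    obtain ⟨a, b, c, hab, hac, hbc, rfl⟩ := Set.ncard_eq_three.1 hcard
    obtain ⟨e, rfl⟩ := exists_edge_eq (hM (by simp : a ∈ _))
    obtain ⟨f, rfl⟩ := exists_edge_eq (hM (by simp : b ∈ _))
    obtain ⟨g, rfl⟩ := exists_edge_eq (hM (by simp : c ∈ _))
    obtain ⟨T, hT, he, hf, hg⟩ := H e f g
      (Arc.disj_of_edge (hdisj (by simp) (by simp) hab))
      (Arc.disj_of_edge (hdisj (by simp) (by simp) hac))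
      (Arc.disj_of_edge (hdisj (by simp) (by simp) hbc))
    refine ⟨_, isPerfectMatchingSet_image hm (by omega) hT, ?_⟩
    rintro _ (rfl | rfl | rfl)
    exacts [⟨e, he, rfl⟩, ⟨f, hf, rfl⟩, ⟨g, hg, rfl⟩]

end TorusMatching

/-- For even `m ≥ 6` and odd `n ≥ 5`, the Cartesian product
`C_m × C_n` is `3`-extendable. -/
theorem cycle_boxProd_cycle_three_extendable (m n : ℕ) (hm : 6 ≤ m) (hme : Even m)
    (hn : 5 ≤ n) (hno : Odd n) :
    Extendable (cycleZMod m □ cycleZMod n) 3 := by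
  obtain ⟨k, rfl⟩ : ∃ k, m = 2 * k + 6 := by
    obtain ⟨a, rfl⟩ := hme
    exact ⟨a - 3, by omega⟩
  obtain ⟨l, rfl⟩ : ∃ l, n = 2 * l + 5 := by
    obtain ⟨a, rfl⟩ := hno
    exact ⟨a - 2, by omega⟩
  exact (TorusMatching.threeExtendable_even_odd k l).extendable (by omega) (by omega)
end

section
/- Let n ≥ 3 be an odd integer. Then the Cartesian product graph C_4 × C_n is not 3-extendable; in particular, writing its vertices as v_{ij} with i ∈ Z/4 and j ∈ Z/n, the 3-matching M = {v_{11}v_{12}, v_{22}v_{32}, v_{31}v_{41}} is not contained in any perfect matching of C_4 × C_n. -/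
open SimpleGraph

/-- The partner map of a perfect matching, as a permutation of the vertices. -/
lemma IsPerfectMatchingSet.exists_perm {V : Type*} {G : SimpleGraph V} {P : Set (Sym2 V)}
    (hP : IsPerfectMatchingSet G P) : ∃ m : Equiv.Perm V, ∀ v w, s(v, w) ∈ P ↔ m v = w := by
  obtain ⟨⟨-, hdisj⟩, hcover⟩ := hP
  have hex : ∀ v, ∃ w, s(v, w) ∈ P := by
    intro v
    obtain ⟨e, he, hv⟩ := hcover v
    obtain ⟨w, rfl⟩ := Sym2.mem_iff_exists.mp hv
    exact ⟨w, he⟩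
  choose m hm using hex
  have huniq : ∀ v w, s(v, w) ∈ P → m v = w := by
    intro v w hw
    by_contra hne
    have hne' : s(v, m v) ≠ s(v, w) := fun h => hne (Sym2.congr_right.mp h)
    exact hdisj (hm v) hw hne' v (Sym2.mem_mk_left _ _) (Sym2.mem_mk_left _ _)
  have hinv : Function.Involutive m := fun v => huniq _ _ (Sym2.eq_swap ▸ hm v)
  exact ⟨hinv.toPerm, fun v w => ⟨huniq v w, fun h => h ▸ hm v⟩⟩

lemma neg_one_pow_val_add_one {n : ℕ} [NeZero n] {a : ZMod n} (ha : a + 1 ≠ 0) :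
    (-1 : ℤ) ^ (a + 1).val = -(-1) ^ a.val := by
  rcases Nat.lt_or_ge (a.val + 1) n with h | h
  · have : Fact (1 < n) := ⟨by omega⟩
    rw [ZMod.val_add_of_lt (by rwa [ZMod.val_one]), ZMod.val_one, pow_succ, mul_neg_one]
  · refine absurd ?_ ha
    have h' : a.val + 1 = n := le_antisymm a.val_lt h
    rw [← ZMod.natCast_zmod_val a, ← Nat.cast_one, ← Nat.cast_add, h', ZMod.natCast_self]

/-- The sign of a vertex in the chequerboard colouring of `C_4 × C_n`
cut between the columns `1` and `2`. -/
def chequerSign (n : ℕ) (v : ZMod 4 × ZMod n) : ℤ :=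
  (-1) ^ v.1.val * (-1) ^ (v.2 - 2).val

lemma sum_chequerSign (n : ℕ) [NeZero n] : ∑ v, chequerSign n v = 0 := by
  have h : ∑ i : ZMod 4, (-1 : ℤ) ^ i.val = 0 := by decide
  simp_rw [chequerSign, Fintype.sum_prod_type, ← Finset.mul_sum, ← Finset.sum_mul, h, zero_mul]

lemma chequerSign_ne_zero (n : ℕ) (v : ZMod 4 × ZMod n) : chequerSign n v ≠ 0 := by
  simp [chequerSign]

lemma chequerSign_one_eq_two {n : ℕ} (hno : Odd n) (i : ZMod 4) :
    chequerSign n (i, 1) = chequerSign n (i, 2) := by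
  obtain ⟨k, rfl⟩ := hno
  have h : (1 : ZMod (2 * k + 1)) - 2 = -1 := by ring
  simp [chequerSign, h, ZMod.val_neg_one]

lemma chequerSign_add_eq_zero {n : ℕ} [NeZero n] {v w : ZMod 4 × ZMod n}
    (h : (cycleZMod 4 □ cycleZMod n).Adj v w) :
    chequerSign n v + chequerSign n w = 0 ∨
      v.1 = w.1 ∧ (v.2 = 1 ∧ w.2 = 2 ∨ v.2 = 2 ∧ w.2 = 1) := by
  obtain ⟨i, j⟩ := v
  obtain ⟨i', j'⟩ := w
  have key : ∀ a : ZMod n, a = 1 ∨ (-1 : ℤ) ^ (a + 1 - 2).val = -(-1) ^ (a - 2).val := by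
    intro a
    by_cases ha : a = 1
    · exact .inl ha
    · right
      rw [add_sub_right_comm]
      refine neg_one_pow_val_add_one fun h0 => ha ?_
      linear_combination h0
  have two : (1 : ZMod n) + 1 = 2 := one_add_one_eq_two
  simp only [boxProd_adj, cycleZMod, SimpleGraph.fromRel_adj] at h
  simp only [chequerSign]
  rcases h with ⟨⟨-, h⟩, rfl⟩ | ⟨⟨-, h⟩, rfl⟩
  · left
    have hrow : ∀ a b : ZMod 4, (b = a + 1 ∨ a = b + 1) →
        (-1 : ℤ) ^ a.val + (-1) ^ b.val = 0 := by decide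
    rw [← add_mul, hrow _ _ h, zero_mul]
  · rcases h with rfl | rfl
    · rcases key j with rfl | hj
      · exact .inr ⟨rfl, .inl ⟨rfl, two⟩⟩
      · left; rw [hj]; ring
    · rcases key j' with rfl | hj
      · exact .inr ⟨rfl, .inr ⟨two, rfl⟩⟩
      · left; rw [hj]; ring

lemma not_exists_isPerfectMatchingSet_cycleFour_boxProd (n : ℕ) (hn : 3 ≤ n) (hno : Odd n) :
    ¬ ∃ P, IsPerfectMatchingSet (cycleZMod 4 □ cycleZMod n) P ∧
        ({s(((1 : ZMod 4), (1 : ZMod n)), ((1 : ZMod 4), (2 : ZMod n))),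
          s(((2 : ZMod 4), (2 : ZMod n)), ((3 : ZMod 4), (2 : ZMod n))),
          s(((3 : ZMod 4), (1 : ZMod n)), ((0 : ZMod 4), (1 : ZMod n)))} :
          Set (Sym2 (ZMod 4 × ZMod n))) ⊆ P := by
  rintro ⟨P, hP, hMP⟩
  have : NeZero n := ⟨by omega⟩
  have : Fact (1 < n) := ⟨by omega⟩
  have h12 : (1 : ZMod n) ≠ 2 := fun h => one_ne_zero (by linear_combination -h : (1 : ZMod n) = 0)
  obtain ⟨m, hm⟩ := hP.exists_perm
  have hadj : ∀ v, (cycleZMod 4 □ cycleZMod n).Adj v (m v) := fun v =>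
    hP.1.1 ((hm v _).mpr rfl)
  simp only [Set.insert_subset_iff, Set.singleton_subset_iff] at hMP
  obtain ⟨e₁, e₂, e₃⟩ := hMP
  have e₁' := e₁
  have e₂' := e₂
  have e₃' := e₃
  rw [Sym2.eq_swap] at e₁' e₂' e₃'
  rw [hm] at e₁ e₂ e₃ e₁' e₂' e₃'
  have hcross : ∀ i, m (i, 1) = (i, 2) → i = 1 := by
    intro i hi
    have hi' : m (i, 2) = (i, 1) := by rw [← hm, Sym2.eq_swap, hm, hi]
    have hrows : ∀ i : ZMod 4, i = 0 ∨ i = 1 ∨ i = 2 ∨ i = 3 := by decide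
    rcases hrows i with rfl | rfl | rfl | rfl
    · rw [hi] at e₃'; exact absurd (congrArg Prod.snd e₃').symm h12
    · rfl
    · rw [hi'] at e₂; exact absurd (congrArg Prod.snd e₂) h12
    · rw [hi'] at e₂'; exact absurd (congrArg Prod.snd e₂') h12
  have hsum : ∑ v, (chequerSign n v + chequerSign n (m v)) = 0 := by
    rw [Finset.sum_add_distrib, Equiv.sum_comp m, sum_chequerSign, add_zero]
  rw [Fintype.sum_eq_add ((1 : ZMod 4), (1 : ZMod n)) (1, 2) (by simpa using h12), e₁, e₁',
    chequerSign_one_eq_two hno] at hsum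
  · exact chequerSign_ne_zero n (1, 2) (by linarith)
  · rintro ⟨i, j⟩ ⟨hne₁, hne₂⟩
    rcases chequerSign_add_eq_zero (hadj (i, j)) with h | ⟨hi, ⟨rfl, h2⟩ | ⟨rfl, h1⟩⟩
    · exact h
    · exact absurd (by rw [hcross i (Prod.ext hi.symm h2)]) hne₁
    · have hmi : m (i, 2) = (i, 1) := Prod.ext hi.symm h1
      have hmi' : m (i, 1) = (i, 2) := by rw [← hm, Sym2.eq_swap, hm, hmi]
      exact absurd (by rw [hcross i hmi']) hne₂

/-- For odd `n ≥ 3`, the graph `C_4 × C_n` is not `3`-extendable;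
in particular, the 3-matching `{v₁₁v₁₂, v₂₂v₃₂, v₃₁v₄₁}` (with `v₄₁ = v₀₁` in `ZMod 4`)
extends to no perfect matching. -/
theorem cycleFour_boxProd_cycle_not_three_extendable (n : ℕ) (hn : 3 ≤ n) (hno : Odd n) :
    ¬ Extendable (cycleZMod 4 □ cycleZMod n) 3 ∧
    ¬ ∃ P, IsPerfectMatchingSet (cycleZMod 4 □ cycleZMod n) P ∧
        ({s(((1 : ZMod 4), (1 : ZMod n)), ((1 : ZMod 4), (2 : ZMod n))),
          s(((2 : ZMod 4), (2 : ZMod n)), ((3 : ZMod 4), (2 : ZMod n))),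
          s(((3 : ZMod 4), (1 : ZMod n)), ((0 : ZMod 4), (1 : ZMod n)))} :
          Set (Sym2 (ZMod 4 × ZMod n))) ⊆ P := by
  have hnot := not_exists_isPerfectMatchingSet_cycleFour_boxProd n hn hno
  refine ⟨fun ⟨_, hext⟩ => hnot (hext _ ⟨?_, ?_⟩ ?_), hnot⟩
  all_goals
    have : Fact (1 < n) := ⟨by omega⟩
    have h12 : (1 : ZMod n) ≠ 2 := fun h =>
      one_ne_zero (by linear_combination -h : (1 : ZMod n) = 0)
    have r01 : (0 : ZMod 4) ≠ 1 := by decide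
    have r02 : (0 : ZMod 4) ≠ 2 := by decide
    have r03 : (0 : ZMod 4) ≠ 3 := by decide
    have r12 : (1 : ZMod 4) ≠ 2 := by decide
    have r13 : (1 : ZMod 4) ≠ 3 := by decide
    have r23 : (2 : ZMod 4) ≠ 3 := by decide
  · have r : (2 : ZMod 4) + 1 = 3 := by decide
    have r' : (3 : ZMod 4) + 1 = 0 := by decide
    simp [Set.insert_subset_iff, boxProd_adj, cycleZMod, h12, r23, r03.symm, r, r',
      one_add_one_eq_two]
  · simp only [Set.Pairwise, Set.mem_insert_iff, Set.mem_singleton_iff]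
    rintro _ (rfl | rfl | rfl) _ (rfl | rfl | rfl) hne v hv <;>
    first
    | exact absurd rfl hne
    | rcases Sym2.mem_iff.mp hv with rfl | rfl <;>
      simp [h12, h12.symm, r01, r02, r03, r12, r13, r01.symm, r02.symm, r03.symm, r12.symm, r13.symm]
  · rw [Set.ncard_eq_three]
    refine ⟨_, _, _, ?_, ?_, ?_, rfl⟩ <;>
    simp [h12, r12, r13, r23, r01.symm, r02.symm, r03.symm]
end
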